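/- arXiv:2411.11334 — 5 statements merged into one kernel-verified Lean document; each statement's English description precedes it below -/
import Mathlib

section
/- Let n ≥ 3, 2−n < b ≤ 0, p > 0 and c ∈ ℝ, and set p_c := np − 2c. Assume either (1) b−2 ≤ c ≤ 0 and −2c < p_c < (2−b)(p+2), or (2) c > 0 and (2−b)p/2 < p_c < (2−b)(p+2). Then there exists a constant C > 0 such that every radially symmetric f ∈ W_b^{1,2} satisfies ∫_{ℝⁿ} |x|^c |f(x)|^{p+2} dx ≤ C (∫_{ℝⁿ} |x|^b |∇f|² dx)^{p_c/(2(2−b))} (∫_{ℝⁿ} |f|² dx)^{((2−b)(p+2)−p_c)/(2(2−b))}. -/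
open MeasureTheory Real Filter

abbrev ESp (n : ℕ) := EuclideanSpace ℝ (Fin n)

noncomputable def wInt (n : ℕ) (a q : ℝ) (f : ESp n → ℂ) : ℝ :=
  ∫ x : ESp n, ‖x‖ ^ a * ‖f x‖ ^ q

noncomputable def gradInt (n : ℕ) (b : ℝ) (f : ESp n → ℂ) : ℝ :=
  ∫ x : ESp n, ‖x‖ ^ b * ‖fderiv ℝ f x‖ ^ 2

/-- Membership in the weighted Sobolev space `W_b^{1,2}`. -/
def memW (n : ℕ) (b : ℝ) (f : ESp n → ℂ) : Prop :=
  Differentiable ℝ f ∧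
  Integrable (fun x : ESp n => ‖f x‖ ^ (2:ℝ)) ∧
  Integrable (fun x : ESp n => ‖x‖ ^ b * ‖fderiv ℝ f x‖ ^ 2)

/-- Radial symmetry. -/
def IsRadial (n : ℕ) (f : ESp n → ℂ) : Prop :=
  ∀ x y : ESp n, ‖x‖ = ‖y‖ → f x = f y

noncomputable def Vterm (n : ℕ) (V : ESp n → ℝ) (φ : ESp n → ℂ) : ℝ :=
  ∫ x : ESp n, V x * ‖φ x‖ ^ 2

noncomputable def VdV (n : ℕ) (V : ESp n → ℝ) (φ : ESp n → ℂ) : ℝ :=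
  ∫ x : ESp n, (fderiv ℝ V x x) * ‖φ x‖ ^ 2

noncomputable def Sfun (n : ℕ) (b c p ω : ℝ) (V : ESp n → ℝ) (φ : ESp n → ℂ) : ℝ :=
  (1/2) * gradInt n b φ + (1/2) * Vterm n V φ + (ω/2) * wInt n 0 2 φ
    - (1/(p+2)) * wInt n c (p+2) φ

noncomputable def Kfun (n : ℕ) (b c p ω α β : ℝ) (V : ESp n → ℝ) (φ : ESp n → ℂ) : ℝ :=
  ((2*α + (2-b-(n:ℝ))*β)/2) * gradInt n b φ
  + ((2*α - (n:ℝ)*β)/2) * (Vterm n V φ + ω * wInt n 0 2 φ)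
  - (β/2) * VdV n V φ
  - ((α*(p+2) - ((n:ℝ)+c)*β)/(p+2)) * wInt n c (p+2) φ

noncomputable def Ebv (n : ℕ) (b c p : ℝ) (V : ESp n → ℝ) (u : ESp n → ℂ) : ℝ :=
  (1/2) * gradInt n b u + (1/2) * Vterm n V u - (1/(p+2)) * wInt n c (p+2) u

noncomputable def Pfun (n : ℕ) (b c p : ℝ) (V : ESp n → ℝ) (u : ESp n → ℂ) : ℝ :=
  gradInt n b u - (1/(2-b)) * VdV n V u
    - (((n:ℝ)*p - 2*c)/((2-b)*(p+2))) * wInt n c (p+2) u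

/-- Weak solution of `∇·(|x|^b ∇Q) − ωQ + |x|^c |Q|^p Q = 0`. -/
def IsWeakSol (n : ℕ) (b c p ω : ℝ) (Q : ESp n → ℂ) : Prop :=
  ∀ ψ : ESp n → ℂ, ContDiff ℝ (⊤ : ℕ∞) ψ → HasCompactSupport ψ →
    (∫ x : ESp n, ((‖x‖ ^ b : ℝ) : ℂ) *
        ∑ i : Fin n, fderiv ℝ Q x (EuclideanSpace.single i 1) *
          starRingEnd ℂ (fderiv ℝ ψ x (EuclideanSpace.single i 1)))
      + (ω : ℂ) * ∫ x : ESp n, Q x * starRingEnd ℂ (ψ x)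
      = ∫ x : ESp n, ((‖x‖ ^ c : ℝ) : ℂ) * ((‖Q x‖ ^ p : ℝ) : ℂ) *
          (Q x * starRingEnd ℂ (ψ x))

noncomputable def mvalV (n : ℕ) (b c p ω α β : ℝ) (V : ESp n → ℝ) : ℝ :=
  sInf {s : ℝ | ∃ ψ : ESp n → ℂ, memW n b ψ ∧ ψ ≠ 0 ∧
    Integrable (fun x : ESp n => ‖x‖ ^ c * ‖ψ x‖ ^ (p+2)) ∧
    Integrable (fun x : ESp n => V x * ‖ψ x‖ ^ 2) ∧
    Integrable (fun x : ESp n => (fderiv ℝ V x x) * ‖ψ x‖ ^ 2) ∧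
    Kfun n b c p ω α β V ψ = 0 ∧ s = Sfun n b c p ω V ψ}

section

open Set

lemma integral_mul_le_sqrt_mul_sqrt {α : Type*} [MeasurableSpace α] {μ : Measure α} {u v : α → ℝ}
    (hu : MemLp u 2 μ) (hv : MemLp v 2 μ) (hu0 : 0 ≤ᵐ[μ] u) (hv0 : 0 ≤ᵐ[μ] v) :
    ∫ x, u x * v x ∂μ ≤ √(∫ x, u x ^ 2 ∂μ) * √(∫ x, v x ^ 2 ∂μ) := by
  have h := integral_mul_le_Lp_mul_Lq_of_nonneg (p := 2) (q := 2) (by constructor <;> norm_num)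
    hu0 hv0 (by simpa using hu) (by simpa using hv)
  simpa [Real.sqrt_eq_rpow] using h

/-- The weighted profile `s ↦ s ^ (k / 2) * ‖h s‖` is square integrable on `(r, ∞)`. -/
lemma memLp_two_weighted {k r : ℝ} (hr : 0 ≤ r) {h : ℝ → ℂ} (hh : Measurable h)
    (hi : IntegrableOn (fun s : ℝ => s ^ k * ‖h s‖ ^ 2) (Ioi 0)) :
    MemLp (fun s : ℝ => s ^ (k / 2) * ‖h s‖) 2 (volume.restrict (Ioi r)) ∧
    ∫ s in Ioi r, (s ^ (k / 2) * ‖h s‖) ^ 2 ≤ ∫ s in Ioi 0, s ^ k * ‖h s‖ ^ 2 := by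
  have hsub : Ioi r ⊆ Ioi (0 : ℝ) := Ioi_subset_Ioi hr
  have heq : EqOn (fun s : ℝ => s ^ k * ‖h s‖ ^ 2) (fun s => (s ^ (k / 2) * ‖h s‖) ^ 2)
      (Ioi r) := by
    intro s hs
    have hs0 : 0 < s := hsub hs
    simp only [mul_pow]
    rw [← Real.rpow_natCast (s ^ (k / 2)), ← Real.rpow_mul hs0.le]
    norm_num
  refine ⟨(memLp_two_iff_integrable_sq (by fun_prop)).2
    ((integrableOn_congr_fun heq measurableSet_Ioi).1 (hi.mono_set hsub)), ?_⟩
  rw [← setIntegral_congr_fun measurableSet_Ioi heq]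
  refine setIntegral_mono_set hi ?_ hsub.eventuallyLE
  filter_upwards [ae_restrict_mem measurableSet_Ioi] with s hs
  have : (0:ℝ) < s := hs
  positivity

section Decay

variable {m b : ℝ} {g : ℝ → ℂ}

lemma norm_sq_le_sqrt_mul_sqrt (hm : 0 ≤ m) (hmb : 0 ≤ m + b / 2) (hg : Differentiable ℝ g)
    (hA : IntegrableOn (fun s : ℝ => s ^ m * ‖g s‖ ^ 2) (Ioi 0))
    (hB : IntegrableOn (fun s : ℝ => s ^ (m + b) * ‖deriv g s‖ ^ 2) (Ioi 0))
    {r : ℝ} (hr : 0 < r) :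
    Tendsto g atTop (nhds 0) ∧
    ‖g r‖ ^ 2 ≤ 2 * r ^ (-(m + b / 2)) *
      (√(∫ s in Ioi 0, s ^ m * ‖g s‖ ^ 2) *
        √(∫ s in Ioi 0, s ^ (m + b) * ‖deriv g s‖ ^ 2)) := by
  have hgm : Measurable g := hg.continuous.measurable
  have hdm : Measurable (deriv g) := measurable_deriv g
  obtain ⟨hu, hu2⟩ := memLp_two_weighted hr.le hgm hA
  obtain ⟨hv, hv2⟩ := memLp_two_weighted hr.le hdm hB
  have huv := hu.integrable_mul hv
  have hbd : ∀ s ∈ Ioi r, ‖g s‖ * ‖deriv g s‖ ≤ r ^ (-(m + b / 2)) *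
      ((s ^ (m / 2) * ‖g s‖) * (s ^ ((m + b) / 2) * ‖deriv g s‖)) := by
    intro s hs
    have hs0 : 0 < s := hr.trans hs
    have h1 : s ^ (m / 2) * s ^ ((m + b) / 2) = s ^ (m + b / 2) := by
      rw [← Real.rpow_add hs0]; congr 1; ring
    have h2 : 1 ≤ r ^ (-(m + b / 2)) * s ^ (m + b / 2) := by
      rw [Real.rpow_neg hr.le, inv_mul_eq_div, one_le_div (by positivity)]
      exact Real.rpow_le_rpow hr.le (le_of_lt hs) hmb
    calc ‖g s‖ * ‖deriv g s‖ ≤ (r ^ (-(m + b / 2)) * s ^ (m + b / 2)) * (‖g s‖ * ‖deriv g s‖) :=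
          le_mul_of_one_le_left (by positivity) h2
      _ = _ := by rw [← h1]; ring
  have hprod : IntegrableOn (fun s => ‖g s‖ * ‖deriv g s‖) (Ioi r) := by
    refine Integrable.mono' (huv.const_mul (r ^ (-(m + b / 2)))) (by fun_prop) ?_
    filter_upwards [ae_restrict_mem measurableSet_Ioi] with s hs
    rw [Real.norm_of_nonneg (by positivity)]
    exact hbd s hs
  have hder : ∀ s ∈ Ici r, HasDerivAt (fun s => ‖g s‖ ^ 2) (2 * inner ℝ (g s) (deriv g s)) s :=
    fun s _ => (hg s).hasDerivAt.norm_sq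
  have hdle : ∀ s, ‖2 * inner ℝ (g s) (deriv g s)‖ ≤ 2 * (‖g s‖ * ‖deriv g s‖) := by
    intro s
    rw [norm_mul, Real.norm_ofNat]
    gcongr
    exact norm_inner_le_norm _ _
  have hdint : IntegrableOn (fun s => 2 * inner ℝ (g s) (deriv g s)) (Ioi r) :=
    Integrable.mono' (hprod.const_mul 2) (by fun_prop) (Eventually.of_forall hdle)
  have hint : IntegrableOn (fun s => ‖g s‖ ^ 2) (Ioi r) := by
    refine Integrable.mono' ((hA.mono_set (Ioi_subset_Ioi hr.le)).const_mul (r ^ (-m)))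
      (by fun_prop) ?_
    filter_upwards [ae_restrict_mem measurableSet_Ioi] with s hs
    rw [Real.norm_of_nonneg (by positivity), ← mul_assoc]
    refine le_mul_of_one_le_left (by positivity) ?_
    rw [Real.rpow_neg hr.le, inv_mul_eq_div, one_le_div (by positivity)]
    exact Real.rpow_le_rpow hr.le (le_of_lt hs) hm
  have hlim : Tendsto (fun s => ‖g s‖ ^ 2) atTop (nhds 0) :=
    tendsto_zero_of_hasDerivAt_of_integrableOn_Ioi
      (fun s hs => hder s (Ioi_subset_Ici_self hs)) hdint hint
  refine ⟨?_, ?_⟩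
  · rw [tendsto_zero_iff_norm_tendsto_zero]
    simpa using hlim.sqrt
  have hftc := integral_Ioi_of_hasDerivAt_of_tendsto'
    hder hdint hlim
  have h0 : ∀ k : ℝ, ∀ h : ℝ → ℂ, 0 ≤ᵐ[volume.restrict (Ioi r)] fun s => s ^ k * ‖h s‖ := by
    intro k h
    filter_upwards [ae_restrict_mem measurableSet_Ioi] with s hs
    have : (0:ℝ) < s := hr.trans hs
    positivity
  calc ‖g r‖ ^ 2 = -∫ s in Ioi r, 2 * inner ℝ (g s) (deriv g s) := by rw [hftc]; ring
    _ ≤ ‖∫ s in Ioi r, 2 * inner ℝ (g s) (deriv g s)‖ := neg_le_abs _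
    _ ≤ ∫ s in Ioi r, 2 * (r ^ (-(m + b / 2)) *
      ((s ^ (m / 2) * ‖g s‖) * (s ^ ((m + b) / 2) * ‖deriv g s‖))) := by
        refine norm_integral_le_of_norm_le ((huv.const_mul _).const_mul 2) ?_
        filter_upwards [ae_restrict_mem measurableSet_Ioi] with s hs
        exact (hdle s).trans (by gcongr 2 * ?_; exact hbd s hs)
    _ = 2 * r ^ (-(m + b / 2)) * ∫ s in Ioi r,
      (s ^ (m / 2) * ‖g s‖) * (s ^ ((m + b) / 2) * ‖deriv g s‖) := by
        rw [integral_const_mul, integral_const_mul, mul_assoc]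
    _ ≤ _ := by
        gcongr
        refine (integral_mul_le_sqrt_mul_sqrt hu hv (h0 _ _) (h0 _ _)).trans ?_
        gcongr

lemma norm_sq_le_rpow_mul (hmb : 0 < m + b - 1) (hg : Differentiable ℝ g)
    (hlim : Tendsto g atTop (nhds 0))
    (hB : IntegrableOn (fun s : ℝ => s ^ (m + b) * ‖deriv g s‖ ^ 2) (Ioi 0))
    {r : ℝ} (hr : 0 < r) :
    ‖g r‖ ^ 2 ≤ r ^ (-(m + b - 1)) / (m + b - 1) *
        ∫ s in Ioi 0, s ^ (m + b) * ‖deriv g s‖ ^ 2 := by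
  have hdm : Measurable (deriv g) := measurable_deriv g
  obtain ⟨hv, hv2⟩ := memLp_two_weighted hr.le hdm hB
  have hlt : -(m + b) < -1 := by linarith
  have heq : EqOn (fun s : ℝ => s ^ (-(m + b))) (fun s => (s ^ (-(m + b) / 2)) ^ 2) (Ioi r) := by
    intro s hs
    have hs0 : 0 < s := hr.trans hs
    simp only
    rw [← Real.rpow_natCast (s ^ (-(m + b) / 2)), ← Real.rpow_mul hs0.le]
    norm_num
  have hw : MemLp (fun s : ℝ => s ^ (-(m + b) / 2)) 2 (volume.restrict (Ioi r)) :=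
    (memLp_two_iff_integrable_sq (by fun_prop)).2
      ((integrableOn_congr_fun heq measurableSet_Ioi).1 (integrableOn_Ioi_rpow_of_lt hlt hr))
  have hw2 : ∫ s in Ioi r, (s ^ (-(m + b) / 2)) ^ 2 = r ^ (-(m + b - 1)) / (m + b - 1) := by
    rw [← setIntegral_congr_fun measurableSet_Ioi heq, integral_Ioi_rpow_of_lt hlt hr]
    rw [show -(m + b) + 1 = -(m + b - 1) by ring, neg_div_neg_eq]
  have hwv := hw.integrable_mul hv
  have hcancel : ∀ s ∈ Ioi r,
      ‖deriv g s‖ = s ^ (-(m + b) / 2) * (s ^ ((m + b) / 2) * ‖deriv g s‖) := by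
    intro s hs
    have hs0 : 0 < s := hr.trans hs
    rw [← mul_assoc, ← Real.rpow_add hs0, neg_div, neg_add_cancel, Real.rpow_zero, one_mul]
  have hnorm : ∀ᵐ s ∂(volume.restrict (Ioi r)),
      ‖deriv g s‖ ≤ s ^ (-(m + b) / 2) * (s ^ ((m + b) / 2) * ‖deriv g s‖) := by
    filter_upwards [ae_restrict_mem measurableSet_Ioi] with s hs using (hcancel s hs).le
  have hdint : IntegrableOn (deriv g) (Ioi r) :=
    Integrable.mono' hwv hdm.aestronglyMeasurable hnorm
  have hftc := integral_Ioi_of_hasDerivAt_of_tendsto'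
    (fun s _ => (hg s).hasDerivAt) hdint hlim
  have hle : ‖g r‖ ≤ √(r ^ (-(m + b - 1)) / (m + b - 1)) *
      √(∫ s in Ioi 0, s ^ (m + b) * ‖deriv g s‖ ^ 2) := by
    calc ‖g r‖ = ‖∫ s in Ioi r, deriv g s‖ := by rw [hftc]; simp
      _ ≤ ∫ s in Ioi r, s ^ (-(m + b) / 2) * (s ^ ((m + b) / 2) * ‖deriv g s‖) :=
        norm_integral_le_of_norm_le hwv hnorm
      _ ≤ _ := by
        rw [← hw2]
        refine (integral_mul_le_sqrt_mul_sqrt hw hv ?_ ?_).trans ?_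
        · filter_upwards [ae_restrict_mem measurableSet_Ioi] with s hs
          exact Real.rpow_nonneg (hr.trans hs).le _
        · filter_upwards [ae_restrict_mem measurableSet_Ioi] with s hs
          exact mul_nonneg (Real.rpow_nonneg (hr.trans hs).le _) (norm_nonneg _)
        · gcongr
  have hB0 : 0 ≤ ∫ s in Ioi 0, s ^ (m + b) * ‖deriv g s‖ ^ 2 :=
    setIntegral_nonneg measurableSet_Ioi fun s hs =>
      mul_nonneg (Real.rpow_nonneg (le_of_lt hs) _) (by positivity)
  calc ‖g r‖ ^ 2 ≤ _ := pow_le_pow_left₀ (norm_nonneg _) hle 2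
    _ = _ := by rw [mul_pow, Real.sq_sqrt (by positivity), Real.sq_sqrt hB0]

/-- One-dimensional weighted Gagliardo–Nirenberg inequality on the half-line: the pointwise bound by
the derivative is used near the origin, the mixed one far from it, and the two regions are separated
at the radius where both contributions balance. -/
lemma integral_rpow_mul_norm_rpow_le {c p P : ℝ} (hb : b ≤ 0) (hm : 0 ≤ m) (hmb : 0 < m + b - 1)
    (hp : 0 < p) (hPdef : P = (m + 1) * p - 2 * c) (hP₁ : (2 - b) * p / 2 ≤ P)
    (hP₂ : P < (2 - b) * (p + 2)) (hg : Differentiable ℝ g)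
    (hA : IntegrableOn (fun s : ℝ => s ^ m * ‖g s‖ ^ 2) (Ioi 0))
    (hB : IntegrableOn (fun s : ℝ => s ^ (m + b) * ‖deriv g s‖ ^ 2) (Ioi 0)) :
    ∫ s in Ioi 0, s ^ (m + c) * ‖g s‖ ^ (p + 2) ≤
      ((1 / (m + b - 1)) ^ ((p + 2) / 2) / (((2 - b) * (p + 2) - P) / 2) + 2 ^ (p / 2)) *
        ((∫ s in Ioi 0, s ^ (m + b) * ‖deriv g s‖ ^ 2) ^ (P / (2 * (2 - b))) *
          (∫ s in Ioi 0, s ^ m * ‖g s‖ ^ 2) ^ (((2 - b) * (p + 2) - P) / (2 * (2 - b)))) := by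
  have hmix := fun {r : ℝ} (hr : 0 < r) =>
    (norm_sq_le_sqrt_mul_sqrt hm (b := b) (by linarith) hg hA hB hr).2
  have hgrad := fun {r : ℝ} (hr : 0 < r) => norm_sq_le_rpow_mul hmb hg
    (norm_sq_le_sqrt_mul_sqrt hm (b := b) (by linarith) hg hA hB one_pos).1 hB hr
  have hA0 : 0 ≤ ∫ s in Ioi 0, s ^ m * ‖g s‖ ^ 2 :=
    setIntegral_nonneg measurableSet_Ioi fun s hs =>
      mul_nonneg (Real.rpow_nonneg (le_of_lt hs) _) (by positivity)
  have hB0 : 0 ≤ ∫ s in Ioi 0, s ^ (m + b) * ‖deriv g s‖ ^ 2 :=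
    setIntegral_nonneg measurableSet_Ioi fun s hs =>
      mul_nonneg (Real.rpow_nonneg (le_of_lt hs) _) (by positivity)
  have hAint : Integrable (fun s : ℝ => s ^ m * ‖g s‖ ^ 2) (volume.restrict (Ioi 0)) := hA
  obtain ⟨A, hAeq⟩ : ∃ A, A = ∫ s in Ioi 0, s ^ m * ‖g s‖ ^ 2 := ⟨_, rfl⟩
  obtain ⟨B, hBeq⟩ : ∃ B, B = ∫ s in Ioi 0, s ^ (m + b) * ‖deriv g s‖ ^ 2 := ⟨_, rfl⟩
  simp only [← hAeq, ← hBeq] at hmix hgrad hA0 hB0 ⊢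
  have hδ : 0 < 2 - b := by linarith
  have hq : 0 < ((2 - b) * (p + 2) - P) / 2 := by linarith
  set q := ((2 - b) * (p + 2) - P) / 2 with hqdef
  have hκ : 0 < 1 / (m + b - 1) := by positivity
  by_cases hdeg : A = 0 ∨ B = 0
  · have hzero : ∀ s ∈ Ioi (0 : ℝ), s ^ (m + c) * ‖g s‖ ^ (p + 2) = 0 := by
      intro s hs
      have h1 : ‖g s‖ ^ 2 ≤ 0 := by
        rcases hdeg with h | h
        · simpa [h] using hmix hs
        · simpa [h] using hgrad hs
      have h2 : ‖g s‖ = 0 := by nlinarith [norm_nonneg (g s)]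
      rw [h2, Real.zero_rpow (by linarith), mul_zero]
    rw [setIntegral_congr_fun measurableSet_Ioi hzero, integral_zero]
    positivity
  push Not at hdeg
  have hA1 : 0 < A := lt_of_le_of_ne hA0 hdeg.1.symm
  have hB1 : 0 < B := lt_of_le_of_ne hB0 hdeg.2.symm
  set R := (A / B) ^ (1 / (2 - b)) with hR
  have hR0 : 0 < R := by positivity
  have hRpow : ∀ t : ℝ, R ^ t = A ^ (t / (2 - b)) * B ^ (-(t / (2 - b))) := by
    intro t
    rw [hR, ← Real.rpow_mul (by positivity), Real.div_rpow hA0 hB0, Real.rpow_neg hB0,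
      div_eq_mul_inv, one_div_mul_eq_div]
  set K₁ := (1 / (m + b - 1)) ^ ((p + 2) / 2) * B ^ ((p + 2) / 2)
  set K₂ := 2 ^ (p / 2) * R ^ (-((P - (2 - b) * p / 2) / 2)) * (√A * √B) ^ (p / 2)
  have hnear : ∀ s, 0 < s → s ^ (m + c) * ‖g s‖ ^ (p + 2) ≤ K₁ * s ^ (q - 1) := by
    intro s hs
    have h1 : ‖g s‖ ^ (p + 2) = (‖g s‖ ^ 2) ^ ((p + 2) / 2) := by
      rw [← Real.rpow_natCast, ← Real.rpow_mul (norm_nonneg _)]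
      congr 1; push_cast; ring
    have h2 : s ^ (q - 1) = s ^ (m + c) * (s ^ (-(m + b - 1))) ^ ((p + 2) / 2) := by
      rw [← Real.rpow_mul hs.le, ← Real.rpow_add hs]
      congr 1; rw [hqdef, hPdef]; ring
    calc s ^ (m + c) * ‖g s‖ ^ (p + 2)
        ≤ s ^ (m + c) * (s ^ (-(m + b - 1)) / (m + b - 1) * B) ^ ((p + 2) / 2) := by
          rw [h1]; gcongr; exact hgrad hs
      _ = K₁ * s ^ (q - 1) := by
          rw [h2, div_eq_mul_one_div, Real.mul_rpow (by positivity) hB0,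
            Real.mul_rpow (by positivity) hκ.le]
          ring
  have hfar : ∀ s, R < s → s ^ (m + c) * ‖g s‖ ^ (p + 2) ≤ K₂ * (s ^ m * ‖g s‖ ^ 2) := by
    intro s hRs
    have hs : 0 < s := hR0.trans hRs
    have h1 : ‖g s‖ ^ (p + 2) = (‖g s‖ ^ 2) ^ (p / 2) * ‖g s‖ ^ 2 := by
      rw [Real.rpow_add_of_nonneg (norm_nonneg _) hp.le zero_le_two, Real.rpow_two,
        ← Real.rpow_natCast, ← Real.rpow_mul (norm_nonneg _)]
      congr 2; push_cast; ring
    have h2 : s ^ (m + c) * (s ^ (-(m + b / 2))) ^ (p / 2) =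
        s ^ (-((P - (2 - b) * p / 2) / 2)) * s ^ m := by
      rw [← Real.rpow_mul hs.le, ← Real.rpow_add hs, ← Real.rpow_add hs]
      congr 1; rw [hPdef]; ring
    have h3 : s ^ (-((P - (2 - b) * p / 2) / 2)) ≤ R ^ (-((P - (2 - b) * p / 2) / 2)) :=
      Real.rpow_le_rpow_of_nonpos hR0 hRs.le (by linarith)
    calc s ^ (m + c) * ‖g s‖ ^ (p + 2)
        ≤ s ^ (m + c) * ((2 * s ^ (-(m + b / 2)) * (√A * √B)) ^ (p / 2) * ‖g s‖ ^ 2) := by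
          rw [h1]; gcongr; exact hmix hs
      _ = 2 ^ (p / 2) * (s ^ (m + c) * (s ^ (-(m + b / 2))) ^ (p / 2)) * (√A * √B) ^ (p / 2) *
            ‖g s‖ ^ 2 := by
          rw [Real.mul_rpow (by positivity) (by positivity),
            Real.mul_rpow (by positivity) (by positivity)]
          ring
      _ ≤ 2 ^ (p / 2) * (R ^ (-((P - (2 - b) * p / 2) / 2)) * s ^ m) * (√A * √B) ^ (p / 2) *
            ‖g s‖ ^ 2 := by
          rw [h2]; gcongr
      _ = _ := by ring
  have hK₁ : 0 ≤ K₁ := by positivity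
  have hK₂ : 0 ≤ K₂ := by positivity
  have hint : IntegrableOn (fun s : ℝ => s ^ (q - 1)) (Ioc 0 R) :=
    (intervalIntegrable_iff_integrableOn_Ioc_of_le hR0.le).1
      (intervalIntegral.intervalIntegrable_rpow' (by linarith))
  have hint' : Integrable ((Ioc 0 R).indicator fun s : ℝ => s ^ (q - 1))
      (volume.restrict (Ioi 0)) :=
    (hint.integrable_indicator measurableSet_Ioc).restrict
  have hval : ∫ s in Ioi 0, (Ioc 0 R).indicator (fun s : ℝ => s ^ (q - 1)) s = R ^ q / q := by
    rw [setIntegral_indicator measurableSet_Ioc, inter_eq_right.2 Ioc_subset_Ioi_self,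
      ← intervalIntegral.integral_of_le hR0.le, integral_rpow (Or.inl (by linarith)),
      sub_add_cancel, Real.zero_rpow hq.ne', sub_zero]
  calc ∫ s in Ioi 0, s ^ (m + c) * ‖g s‖ ^ (p + 2)
      ≤ ∫ s in Ioi 0, (K₁ * (Ioc 0 R).indicator (fun s : ℝ => s ^ (q - 1)) s +
          K₂ * (s ^ m * ‖g s‖ ^ 2)) := by
        refine integral_mono_of_nonneg ?_ ((hint'.const_mul K₁).add (hAint.const_mul K₂)) ?_
        · filter_upwards [ae_restrict_mem measurableSet_Ioi] with s hs
          exact mul_nonneg (Real.rpow_nonneg (le_of_lt hs) _) (by positivity)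
        · filter_upwards [ae_restrict_mem measurableSet_Ioi] with s hs
          have hs0 : (0 : ℝ) < s := hs
          rcases le_or_gt s R with h | h
          · rw [indicator_of_mem (show s ∈ Ioc 0 R from ⟨hs0, h⟩)]
            exact (hnear s hs0).trans (le_add_of_nonneg_right (by positivity))
          · rw [indicator_of_notMem (fun hmem : s ∈ Ioc 0 R => h.not_ge hmem.2), mul_zero, zero_add]
            exact hfar s h
    _ = K₁ * (R ^ q / q) + K₂ * A := by
        rw [integral_add (hint'.const_mul K₁) (hAint.const_mul K₂), integral_const_mul,
          integral_const_mul, hval, ← hAeq]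
    _ = _ := by
        have hK₁eq : B ^ ((p + 2) / 2) * R ^ q =
            B ^ (P / (2 * (2 - b))) * A ^ (((2 - b) * (p + 2) - P) / (2 * (2 - b))) := by
          rw [hRpow, mul_left_comm, ← Real.rpow_add hB1, mul_comm]
          congr 2 <;> rw [hqdef] <;> field_simp
          ring
        have hK₂eq : R ^ (-((P - (2 - b) * p / 2) / 2)) * (√A * √B) ^ (p / 2) * A =
            B ^ (P / (2 * (2 - b))) * A ^ (((2 - b) * (p + 2) - P) / (2 * (2 - b))) := by
          rw [hRpow, Real.mul_rpow (by positivity) (by positivity), Real.sqrt_eq_rpow,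
            Real.sqrt_eq_rpow, ← Real.rpow_mul hA0, ← Real.rpow_mul hB0]
          calc _ = (B ^ (-(-((P - (2 - b) * p / 2) / 2) / (2 - b))) * B ^ (1 / 2 * (p / 2))) *
                (A ^ (-((P - (2 - b) * p / 2) / 2) / (2 - b)) * A ^ (1 / 2 * (p / 2)) *
                  A ^ (1 : ℝ)) := by rw [Real.rpow_one]; ring
            _ = _ := by
              rw [← Real.rpow_add hB1, ← Real.rpow_add hA1, ← Real.rpow_add hA1]
              congr 2 <;> field_simp <;> ring
        rw [add_mul, ← hK₁eq]
        nth_rewrite 2 [hK₁eq]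
        rw [← hK₂eq]
        ring

end Decay

section Radial

variable {n : ℕ}

lemma integral_rpow_mul_comp_norm (hn : 1 ≤ n) (a : ℝ) (φ : ℝ → ℝ) :
    ∫ x : ESp n, ‖x‖ ^ a * φ ‖x‖ = (n * volume.real (Metric.ball (0 : ESp n) 1)) *
      ∫ s in Ioi (0 : ℝ), s ^ ((n : ℝ) - 1 + a) * φ s := by
  have : Nonempty (Fin n) := ⟨⟨0, hn⟩⟩
  rw [integral_fun_norm_addHaar volume (fun s : ℝ => s ^ a * φ s), finrank_euclideanSpace_fin,
    nsmul_eq_mul, smul_eq_mul, mul_assoc]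
  congr 2
  refine setIntegral_congr_fun measurableSet_Ioi fun s hs => ?_
  simp only [smul_eq_mul]
  rw [Real.rpow_add hs, ← Nat.cast_pred hn, Real.rpow_natCast, mul_assoc]

lemma integrableOn_of_integrable_comp_norm (hn : 1 ≤ n) {a : ℝ} {φ : ℝ → ℝ}
    (h : Integrable fun x : ESp n => ‖x‖ ^ a * φ ‖x‖) :
    IntegrableOn (fun s : ℝ => s ^ ((n : ℝ) - 1 + a) * φ s) (Ioi 0) := by
  have : Nonempty (Fin n) := ⟨⟨0, hn⟩⟩
  rw [integrable_fun_norm_addHaar volume (f := fun s : ℝ => s ^ a * φ s),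
    finrank_euclideanSpace_fin] at h
  refine (integrableOn_congr_fun (fun s hs => ?_) measurableSet_Ioi).1 h
  simp only [smul_eq_mul]
  rw [Real.rpow_add hs, ← Nat.cast_pred hn, Real.rpow_natCast, mul_assoc]

/-- A differentiable radial function has a differentiable profile whose derivative is controlled
by the full derivative. -/
lemma exists_radial_profile (hn : 1 ≤ n) {f : ESp n → ℂ} (hf : Differentiable ℝ f)
    (hrad : IsRadial n f) :
    ∃ g : ℝ → ℂ, Differentiable ℝ g ∧ (∀ x, f x = g ‖x‖) ∧
      ∀ x ≠ 0, ‖deriv g ‖x‖‖ ≤ ‖fderiv ℝ f x‖ := by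
  set e : ESp n := EuclideanSpace.single ⟨0, hn⟩ 1
  have he : ‖e‖ = 1 := by simp [e]
  refine ⟨fun t => f (t • e), by fun_prop, fun x => hrad _ _ (by simp [norm_smul, he]), ?_⟩
  intro x hx
  have hx0 : ‖x‖ ≠ 0 := norm_ne_zero_iff.2 hx
  set u : ESp n := ‖x‖⁻¹ • x
  have hu : ‖u‖ = 1 := by simp [u, norm_smul, hx0]
  have hxu : ‖x‖ • u = x := by simp [u, smul_smul, hx0]
  have heq : (fun t : ℝ => f (t • e)) = fun t => f (t • u) := by
    funext t
    exact hrad _ _ (by simp [norm_smul, he, hu])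
  have hline : HasDerivAt (fun t : ℝ => t • u) u ‖x‖ := by
    simpa using (hasDerivAt_id ‖x‖).smul_const u
  have hfx : HasFDerivAt f (fderiv ℝ f x) (‖x‖ • u) := by
    rw [hxu]; exact (hf x).hasFDerivAt
  have hd := hfx.comp_hasDerivAt ‖x‖ hline
  rw [heq, show deriv (fun t : ℝ => f (t • u)) ‖x‖ = fderiv ℝ f x u from hd.deriv]
  simpa [hu] using (fderiv ℝ f x).le_opNorm u

end Radial

end

/-- sharp radial Gagliardo–Nirenberg inequality in `W_b^{1,2}`. -/
theorem radial_gagliardo_nirenberg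
    (n : ℕ) (hn : 3 ≤ n) (b c p : ℝ)
    (hb1 : 2 - (n:ℝ) < b) (hb2 : b ≤ 0) (hp : 0 < p)
    (hcase :
      (b - 2 ≤ c ∧ c ≤ 0 ∧ -2*c < (n:ℝ)*p - 2*c ∧ (n:ℝ)*p - 2*c < (2-b)*(p+2)) ∨
      (0 < c ∧ (2-b)*p/2 < (n:ℝ)*p - 2*c ∧ (n:ℝ)*p - 2*c < (2-b)*(p+2))) :
    ∃ C > 0, ∀ f : ESp n → ℂ, memW n b f → IsRadial n f →
      wInt n c (p+2) f ≤
        C * (gradInt n b f) ^ (((n:ℝ)*p - 2*c)/(2*(2-b))) *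
          (wInt n 0 2 f) ^ (((2-b)*(p+2) - ((n:ℝ)*p - 2*c))/(2*(2-b))) := by
  set P := (n : ℝ) * p - 2 * c with hP
  have hn3 : (3 : ℝ) ≤ n := by exact_mod_cast hn
  have hn1 : 1 ≤ n := by omega
  have hδ : 0 < 2 - b := by linarith
  have hP₁ : (2 - b) * p / 2 ≤ P := by
    rcases hcase with ⟨-, hc, -, -⟩ | ⟨-, h, -⟩
    · nlinarith
    · exact h.le
  have hP₂ : P < (2 - b) * (p + 2) := by
    rcases hcase with ⟨-, -, -, h⟩ | ⟨-, -, h⟩ <;> exact h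
  have hP₀ : 0 < P := lt_of_lt_of_le (by positivity) hP₁
  have hα : 0 ≤ P / (2 * (2 - b)) := by positivity
  have hβ : 0 ≤ ((2 - b) * (p + 2) - P) / (2 * (2 - b)) :=
    div_nonneg (by linarith) (by positivity)
  set α := P / (2 * (2 - b)) with hαdef
  set β := ((2 - b) * (p + 2) - P) / (2 * (2 - b)) with hβdef
  set K := (1 / ((n : ℝ) - 1 + b - 1)) ^ ((p + 2) / 2) / (((2 - b) * (p + 2) - P) / 2) +
    2 ^ (p / 2) with hK
  have hK0 : 0 < K := by
    have h1 : 0 < (n : ℝ) - 1 + b - 1 := by linarith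
    have h2 : 0 < ((2 - b) * (p + 2) - P) / 2 := by linarith
    positivity
  set ω := (n : ℝ) * volume.real (Metric.ball (0 : ESp n) 1) with hω
  have hω0 : 0 < ω := mul_pos (by linarith)
    (ENNReal.toReal_pos (Metric.measure_ball_pos _ _ one_pos).ne' measure_ball_lt_top.ne)
  refine ⟨ω * K / (ω ^ α * ω ^ β), by positivity, ?_⟩
  rintro f ⟨hf, hfA, hfB⟩ hrad
  obtain ⟨g, hg, hfg, hder⟩ := exists_radial_profile hn1 hf hrad
  have hle : (fun x : ESp n => ‖x‖ ^ b * ‖deriv g ‖x‖‖ ^ 2) ≤ᵐ[volume]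
      fun x => ‖x‖ ^ b * ‖fderiv ℝ f x‖ ^ 2 := by
    have : Nonempty (Fin n) := ⟨⟨0, hn1⟩⟩
    filter_upwards [compl_mem_ae_iff.2 (measure_singleton (0 : ESp n))] with x hx
    gcongr
    exact hder x hx
  have hdm : Measurable (deriv g) := measurable_deriv g
  have hgB : Integrable fun x : ESp n => ‖x‖ ^ b * ‖deriv g ‖x‖‖ ^ 2 := by
    refine Integrable.mono' hfB ?_ ?_
    · exact Measurable.aestronglyMeasurable (by fun_prop)
    · filter_upwards [hle] with x hx
      rwa [Real.norm_of_nonneg (by positivity)]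
  have hgA : Integrable fun x : ESp n => ‖x‖ ^ (0 : ℝ) * ‖g ‖x‖‖ ^ 2 := by
    simpa [hfg] using hfA
  have hM : wInt n 0 2 f = ω * ∫ s in Set.Ioi 0, s ^ ((n : ℝ) - 1) * ‖g s‖ ^ 2 := by
    simp only [wInt, hfg, Real.rpow_two]
    rw [integral_rpow_mul_comp_norm hn1 0 (fun s => ‖g s‖ ^ 2), add_zero]
  have hG : ω * ∫ s in Set.Ioi 0, s ^ ((n : ℝ) - 1 + b) * ‖deriv g s‖ ^ 2 ≤ gradInt n b f := by
    rw [hω, ← integral_rpow_mul_comp_norm hn1 b (fun s => ‖deriv g s‖ ^ 2)]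
    exact integral_mono_ae hgB hfB hle
  have hI : wInt n c (p + 2) f =
      ω * ∫ s in Set.Ioi 0, s ^ ((n : ℝ) - 1 + c) * ‖g s‖ ^ (p + 2) := by
    simp only [wInt, hfg]
    rw [integral_rpow_mul_comp_norm hn1 c (fun s => ‖g s‖ ^ (p + 2))]
  have hA := integrableOn_of_integrable_comp_norm hn1 (φ := fun s => ‖g s‖ ^ 2) hgA
  have hB := integrableOn_of_integrable_comp_norm hn1 (φ := fun s => ‖deriv g s‖ ^ 2) hgB
  rw [add_zero] at hA
  have hmain := integral_rpow_mul_norm_rpow_le (c := c) (P := P) hb2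
    (by linarith) (by linarith) hp (by rw [hP]; ring) hP₁ hP₂ hg hA hB
  rw [← hK, ← hαdef, ← hβdef] at hmain
  have hA0 : 0 ≤ ∫ s in Set.Ioi 0, s ^ ((n : ℝ) - 1) * ‖g s‖ ^ 2 :=
    setIntegral_nonneg measurableSet_Ioi fun s hs =>
      mul_nonneg (Real.rpow_nonneg (le_of_lt hs) _) (by positivity)
  have hB0 : 0 ≤ ∫ s in Set.Ioi 0, s ^ ((n : ℝ) - 1 + b) * ‖deriv g s‖ ^ 2 :=
    setIntegral_nonneg measurableSet_Ioi fun s hs =>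
      mul_nonneg (Real.rpow_nonneg (le_of_lt hs) _) (by positivity)
  set A := ∫ s in Set.Ioi 0, s ^ ((n : ℝ) - 1) * ‖g s‖ ^ 2
  set B := ∫ s in Set.Ioi 0, s ^ ((n : ℝ) - 1 + b) * ‖deriv g s‖ ^ 2
  rw [hI, hM]
  calc ω * ∫ s in Set.Ioi 0, s ^ ((n : ℝ) - 1 + c) * ‖g s‖ ^ (p + 2)
      ≤ ω * (K * (B ^ α * A ^ β)) := by gcongr
    _ = ω * K / (ω ^ α * ω ^ β) * (ω * B) ^ α * (ω * A) ^ β := by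
        rw [Real.mul_rpow hω0.le hB0, Real.mul_rpow hω0.le hA0]
        field_simp
    _ ≤ _ := by gcongr
end

section
/- Let n ≥ 2 and b ≥ 2−2n. There exists a constant C > 0, depending only on n and b, such that every radially symmetric f ∈ W_b^{1,2} satisfies the weighted Strauss inequality: for almost every x ∈ ℝⁿ, |x|^{(2n−2+b)/4} |f(x)| ≤ C (∫_{ℝⁿ} |x|^b |∇f|² dx)^{1/4} (∫_{ℝⁿ} |f|² dx)^{1/4}. -/
open MeasureTheory Real Filter

/-- The product of two weighted square-integrable functions, with the Cauchy-Schwarz bound. -/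
lemma integrableOn_rpow_mul_norm_mul_norm {u v : ℝ → ℂ} {p q : ℝ}
    (hum : Measurable u) (hvm : Measurable v)
    (hu : IntegrableOn (fun s : ℝ => s ^ p * ‖u s‖ ^ 2) (Set.Ioi 0))
    (hv : IntegrableOn (fun s : ℝ => s ^ q * ‖v s‖ ^ 2) (Set.Ioi 0)) :
    IntegrableOn (fun s : ℝ => s ^ ((p + q) / 2) * (‖u s‖ * ‖v s‖)) (Set.Ioi 0) ∧
    ∫ s in Set.Ioi (0 : ℝ), s ^ ((p + q) / 2) * (‖u s‖ * ‖v s‖) ≤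
      √(∫ s in Set.Ioi (0 : ℝ), s ^ p * ‖u s‖ ^ 2) *
        √(∫ s in Set.Ioi (0 : ℝ), s ^ q * ‖v s‖ ^ 2) := by
  have hsq : ∀ (w : ℝ → ℂ) (a : ℝ), ∀ s ∈ Set.Ioi (0 : ℝ),
      (s ^ (a / 2) * ‖w s‖) ^ 2 = s ^ a * ‖w s‖ ^ 2 := by
    intro w a s hs
    rw [mul_pow, ← Real.rpow_mul_natCast (le_of_lt hs)]
    norm_num
  have hmem : ∀ (w : ℝ → ℂ) (a : ℝ), Measurable w →
      IntegrableOn (fun s : ℝ => s ^ a * ‖w s‖ ^ 2) (Set.Ioi 0) →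
      MemLp (fun s : ℝ => s ^ (a / 2) * ‖w s‖) 2 (volume.restrict (Set.Ioi 0)) := by
    intro w a hw hint
    have hmeas : Measurable (fun s : ℝ => s ^ (a / 2) * ‖w s‖) := by fun_prop
    rw [memLp_two_iff_integrable_sq hmeas.aestronglyMeasurable]
    exact hint.congr_fun (fun s hs => (hsq w a s hs).symm) measurableSet_Ioi
  have hprod : ∀ s ∈ Set.Ioi (0 : ℝ), (s ^ (p / 2) * ‖u s‖) * (s ^ (q / 2) * ‖v s‖) =
      s ^ ((p + q) / 2) * (‖u s‖ * ‖v s‖) := by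
    intro s hs
    rw [add_div, Real.rpow_add hs]
    ring
  have hU := hmem u p hum hu
  have hV := hmem v q hvm hv
  refine ⟨IntegrableOn.congr_fun (hU.integrable_mul hV) hprod measurableSet_Ioi, ?_⟩
  have hnonneg : ∀ (w : ℝ → ℂ) (a : ℝ),
      0 ≤ᵐ[volume.restrict (Set.Ioi 0)] (fun s : ℝ => s ^ (a / 2) * ‖w s‖) := by
    intro w a
    filter_upwards [ae_restrict_mem measurableSet_Ioi] with s hs
    exact mul_nonneg (Real.rpow_nonneg (le_of_lt hs) _) (norm_nonneg _)
  have hCS := integral_mul_le_Lp_mul_Lq_of_nonneg Real.HolderConjugate.two_two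
    (hnonneg u p) (hnonneg v q) (by simpa using hU) (by simpa using hV)
  simp only [Real.rpow_two] at hCS
  rwa [setIntegral_congr_fun measurableSet_Ioi hprod,
    setIntegral_congr_fun measurableSet_Ioi (hsq u p),
    setIntegral_congr_fun measurableSet_Ioi (hsq v q), ← Real.sqrt_eq_rpow,
    ← Real.sqrt_eq_rpow] at hCS

/-- A weighted one-dimensional Strauss inequality on the half-line. -/
lemma rpow_mul_norm_sq_le_of_integrableOn {g : ℝ → ℂ} (hg : Differentiable ℝ g) {p q : ℝ}
    (hp : 0 ≤ p) (hpq : 0 ≤ p + q)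
    (hu : IntegrableOn (fun s : ℝ => s ^ p * ‖g s‖ ^ 2) (Set.Ioi 0))
    (hv : IntegrableOn (fun s : ℝ => s ^ q * ‖deriv g s‖ ^ 2) (Set.Ioi 0))
    {r : ℝ} (hr : 0 < r) :
    r ^ ((p + q) / 2) * ‖g r‖ ^ 2 ≤
      2 * (√(∫ s in Set.Ioi (0 : ℝ), s ^ p * ‖g s‖ ^ 2) *
        √(∫ s in Set.Ioi (0 : ℝ), s ^ q * ‖deriv g s‖ ^ 2)) := by
  obtain ⟨hint, hCS⟩ := integrableOn_rpow_mul_norm_mul_norm hg.continuous.measurable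
    (measurable_deriv g) hu hv
  refine le_trans ?_ (mul_le_mul_of_nonneg_left hCS zero_le_two)
  set m := (p + q) / 2 with hm
  have hm0 : 0 ≤ m := by positivity
  set M := ∫ s in Set.Ioi (0 : ℝ), s ^ m * (‖g s‖ * ‖deriv g s‖) with hM
  have hrm : 0 < r ^ m := Real.rpow_pos_of_pos hr m
  have hbound : ∀ s, r ≤ s → ‖2 * inner ℝ (g s) (deriv g s)‖ ≤
      2 * (r ^ m)⁻¹ * (s ^ m * (‖g s‖ * ‖deriv g s‖)) := by
    intro s hs
    have h1 : ‖inner ℝ (g s) (deriv g s)‖ ≤ ‖g s‖ * ‖deriv g s‖ := norm_inner_le_norm _ _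
    have h2 : 1 ≤ (r ^ m)⁻¹ * s ^ m := by
      rw [← div_eq_inv_mul, one_le_div hrm]
      exact Real.rpow_le_rpow hr.le hs hm0
    have h3 : 0 ≤ ‖g s‖ * ‖deriv g s‖ := by positivity
    rw [norm_mul, Real.norm_two]
    nlinarith [mul_le_mul_of_nonneg_right h2 h3]
  have hincr : ∀ R, r ≤ R → ‖g r‖ ^ 2 - 2 * (r ^ m)⁻¹ * M ≤ ‖g R‖ ^ 2 := by
    intro R hR
    have hsub : Set.Ioc r R ⊆ Set.Ioi 0 := fun s hs => hr.trans hs.1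
    have hdom : IntegrableOn
        (fun s : ℝ => 2 * (r ^ m)⁻¹ * (s ^ m * (‖g s‖ * ‖deriv g s‖))) (Set.Ioc r R) :=
      (hint.mono_set hsub).const_mul _
    have hmeas : Measurable (fun s => 2 * inner ℝ (g s) (deriv g s)) :=
      (hg.continuous.measurable.inner (measurable_deriv g)).const_mul 2
    have hii : IntervalIntegrable (fun s => 2 * inner ℝ (g s) (deriv g s)) volume r R := by
      rw [intervalIntegrable_iff_integrableOn_Ioc_of_le hR]
      refine Integrable.mono' hdom hmeas.aestronglyMeasurable ?_
      filter_upwards [ae_restrict_mem measurableSet_Ioc] with s hs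
      exact hbound s hs.1.le
    have hFTC := intervalIntegral.integral_eq_sub_of_hasDerivAt
      (fun s _ => (hg s).hasDerivAt.norm_sq) hii
    have hle : ‖∫ s in r..R, 2 * inner ℝ (g s) (deriv g s)‖ ≤ 2 * (r ^ m)⁻¹ * M := by
      calc ‖∫ s in r..R, 2 * inner ℝ (g s) (deriv g s)‖
          ≤ ∫ s in r..R, 2 * (r ^ m)⁻¹ * (s ^ m * (‖g s‖ * ‖deriv g s‖)) := by
            refine intervalIntegral.norm_integral_le_of_norm_le hR ?_
              ((intervalIntegrable_iff_integrableOn_Ioc_of_le hR).2 hdom)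
            exact Eventually.of_forall fun s hs => hbound s hs.1.le
        _ ≤ ∫ s in Set.Ioi 0, 2 * (r ^ m)⁻¹ * (s ^ m * (‖g s‖ * ‖deriv g s‖)) := by
            rw [intervalIntegral.integral_of_le hR]
            refine setIntegral_mono_set (hint.const_mul _) ?_ hsub.eventuallyLE
            filter_upwards [ae_restrict_mem measurableSet_Ioi] with s hs
            have : 0 ≤ s ^ m := Real.rpow_nonneg (le_of_lt hs) m
            positivity
        _ = 2 * (r ^ m)⁻¹ * M := integral_const_mul _ _
    rw [hFTC, Real.norm_eq_abs] at hle
    linarith [(abs_le.1 hle).1]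
  by_contra! hlt
  set ε := ‖g r‖ ^ 2 - 2 * (r ^ m)⁻¹ * M with hε
  have hεpos : 0 < ε := by
    have : r ^ m * ε = r ^ m * ‖g r‖ ^ 2 - 2 * M := by
      rw [hε]
      field_simp
    exact pos_of_mul_pos_right (by linarith) hrm.le
  have hrp : 0 < r ^ p := Real.rpow_pos_of_pos hr p
  have hconst : IntegrableOn (fun _ : ℝ => r ^ p * ε) (Set.Ioi r) := by
    refine Integrable.mono' (hu.mono_set (Set.Ioi_subset_Ioi hr.le))
      aestronglyMeasurable_const ?_
    filter_upwards [ae_restrict_mem measurableSet_Ioi] with s hs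
    rw [Real.norm_of_nonneg (by positivity)]
    exact mul_le_mul (Real.rpow_le_rpow hr.le (le_of_lt hs) hp) (hincr s (le_of_lt hs)) hεpos.le
      (Real.rpow_nonneg (hr.le.trans (le_of_lt hs)) p)
  rw [integrableOn_const_iff] at hconst
  simp [hrp.ne', hεpos.ne'] at hconst

/-- The norm of the differential of a radial function is radial. -/
lemma IsRadial.norm_fderiv_eq {n : ℕ} {f : ESp n → ℂ} (hf : IsRadial n f) {x y : ESp n}
    (hxy : ‖x‖ = ‖y‖) : ‖fderiv ℝ f x‖ = ‖fderiv ℝ f y‖ := by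
  set e := (Submodule.span ℝ {x - y})ᗮ.reflection with he
  have hex : e x = y := Submodule.reflection_sub hxy
  have hcomp : f ∘ e.toContinuousLinearEquiv = f :=
    funext fun z => hf _ _ (e.norm_map z)
  have h := e.toContinuousLinearEquiv.comp_right_fderiv (f := f) (x := x)
  rw [hcomp] at h
  rw [h]
  refine (ContinuousLinearMap.opNorm_comp_linearIsometryEquiv _ e).trans ?_
  change ‖fderiv ℝ f (e x)‖ = _
  rw [hex]

/-- weighted radial Strauss inequality. -/
theorem weighted_strauss
    (n : ℕ) (hn : 2 ≤ n) (b : ℝ) (hb : 2 - 2*(n:ℝ) ≤ b) :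
    ∃ C > 0, ∀ f : ESp n → ℂ, memW n b f → IsRadial n f →
      ∀ᵐ x : ESp n,
        ‖x‖ ^ ((2*(n:ℝ) - 2 + b)/4) * ‖f x‖ ≤
          C * (gradInt n b f) ^ ((1:ℝ)/4) * (wInt n 0 2 f) ^ ((1:ℝ)/4) := by
  have : NeZero n := ⟨by omega⟩
  have hn' : (2 : ℝ) ≤ n := by exact_mod_cast hn
  set κ : ℝ := n * (volume : Measure (ESp n)).real (Metric.ball 0 1) with hκ
  have hκ0 : 0 < κ := by
    refine mul_pos (by linarith) (ENNReal.toReal_pos ?_ measure_ball_lt_top.ne)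
    exact (Metric.measure_ball_pos _ _ one_pos).ne'
  refine ⟨√(2 / κ), by positivity, fun f ⟨hdiff, hL2, hgrad⟩ hrad => ?_⟩
  set e : ESp n := EuclideanSpace.single 0 1 with he
  have hnorme : ‖e‖ = 1 := by simp [he]
  have hline : ∀ x : ESp n, ‖x‖ = ‖‖x‖ • e‖ := fun x => by simp [norm_smul, hnorme]
  set g : ℝ → ℂ := fun s => f (s • e) with hg
  set G : ℝ → ℝ := fun s => ‖fderiv ℝ f (s • e)‖ with hG
  have hfg : ∀ x, f x = g ‖x‖ := fun x => hrad _ _ (hline x)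
  have hfG : ∀ x, ‖fderiv ℝ f x‖ = G ‖x‖ := fun x => hrad.norm_fderiv_eq (hline x)
  have hderiv : ∀ s, HasDerivAt g (fderiv ℝ f (s • e) e) s := fun s => by
    have h := (hdiff (s • e)).hasFDerivAt.comp_hasDerivAt s ((hasDerivAt_id s).smul_const e)
    rwa [one_smul] at h
  have hgdiff : Differentiable ℝ g := fun s => (hderiv s).differentiableAt
  have hderiv_le : ∀ s, ‖deriv g s‖ ≤ G s := fun s => by
    rw [(hderiv s).deriv]
    simpa [hnorme] using (fderiv ℝ f (s • e)).le_opNorm e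
  have hpow : ∀ s ∈ Set.Ioi (0 : ℝ), s ^ (n - 1) = s ^ ((n : ℝ) - 1) := fun s _ => by
    rw [← Real.rpow_natCast, Nat.cast_sub (by omega), Nat.cast_one]
  have hwu : ∀ s ∈ Set.Ioi (0 : ℝ),
      s ^ (n - 1) • ‖g s‖ ^ 2 = s ^ ((n : ℝ) - 1) * ‖g s‖ ^ 2 := fun s hs => by
    rw [hpow s hs, smul_eq_mul]
  have hwv : ∀ s ∈ Set.Ioi (0 : ℝ),
      s ^ (n - 1) • (s ^ b * G s ^ 2) = s ^ ((n : ℝ) - 1 + b) * G s ^ 2 := fun s hs => by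
    rw [hpow s hs, smul_eq_mul, Real.rpow_add hs, mul_assoc]
  have hu : IntegrableOn (fun s : ℝ => s ^ ((n : ℝ) - 1) * ‖g s‖ ^ 2) (Set.Ioi 0) := by
    simp only [hfg, Real.rpow_two] at hL2
    have h := (integrable_fun_norm_addHaar (volume : Measure (ESp n))
      (f := fun s => ‖g s‖ ^ 2)).1 hL2
    rw [finrank_euclideanSpace_fin] at h
    exact h.congr_fun hwu measurableSet_Ioi
  have hv : IntegrableOn (fun s : ℝ => s ^ ((n : ℝ) - 1 + b) * G s ^ 2) (Set.Ioi 0) := by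
    simp only [hfG] at hgrad
    have h := (integrable_fun_norm_addHaar (volume : Measure (ESp n))
      (f := fun s => s ^ b * G s ^ 2)).1 hgrad
    rw [finrank_euclideanSpace_fin] at h
    exact h.congr_fun hwv measurableSet_Ioi
  have hle : ∀ s ∈ Set.Ioi (0 : ℝ), s ^ ((n : ℝ) - 1 + b) * ‖deriv g s‖ ^ 2 ≤
      s ^ ((n : ℝ) - 1 + b) * G s ^ 2 := fun s hs =>
    mul_le_mul_of_nonneg_left (pow_le_pow_left₀ (norm_nonneg _) (hderiv_le s) 2)
      (Real.rpow_nonneg (le_of_lt hs) _)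
  have hv' : IntegrableOn (fun s : ℝ => s ^ ((n : ℝ) - 1 + b) * ‖deriv g s‖ ^ 2)
      (Set.Ioi 0) := by
    have hmd := measurable_deriv g
    have hmeas : Measurable (fun s : ℝ => s ^ ((n : ℝ) - 1 + b) * ‖deriv g s‖ ^ 2) := by
      fun_prop
    refine Integrable.mono' hv hmeas.aestronglyMeasurable ?_
    filter_upwards [ae_restrict_mem measurableSet_Ioi] with s hs
    have : 0 ≤ s ^ ((n : ℝ) - 1 + b) := Real.rpow_nonneg (le_of_lt hs) _
    rw [Real.norm_of_nonneg (by positivity)]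
    exact hle s hs
  set A := ∫ s in Set.Ioi (0 : ℝ), s ^ ((n : ℝ) - 1) * ‖g s‖ ^ 2 with hA
  set B := ∫ s in Set.Ioi (0 : ℝ), s ^ ((n : ℝ) - 1 + b) * G s ^ 2 with hB
  have hW : wInt n 0 2 f = κ * A := by
    have h := integral_fun_norm_addHaar (volume : Measure (ESp n)) (fun s => ‖g s‖ ^ 2)
    rw [finrank_euclideanSpace_fin, setIntegral_congr_fun measurableSet_Ioi hwu] at h
    simp only [wInt, hfg, Real.rpow_zero, one_mul, Real.rpow_two]
    rw [h, hκ, nsmul_eq_mul, smul_eq_mul, mul_assoc]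
  have hD : gradInt n b f = κ * B := by
    have h := integral_fun_norm_addHaar (volume : Measure (ESp n)) (fun s => s ^ b * G s ^ 2)
    rw [finrank_euclideanSpace_fin, setIntegral_congr_fun measurableSet_Ioi hwv] at h
    simp only [gradInt, hfG]
    rw [h, hκ, nsmul_eq_mul, smul_eq_mul, mul_assoc]
  have hA0 : 0 ≤ A := setIntegral_nonneg measurableSet_Ioi fun s hs =>
    mul_nonneg (Real.rpow_nonneg (le_of_lt hs) _) (sq_nonneg _)
  have hB0 : 0 ≤ B := setIntegral_nonneg measurableSet_Ioi fun s hs =>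
    mul_nonneg (Real.rpow_nonneg (le_of_lt hs) _) (sq_nonneg _)
  have hquarter : ∀ t : ℝ, 0 ≤ t → (t ^ ((1 : ℝ) / 4)) ^ 2 = √t := fun t ht => by
    rw [← Real.rpow_mul_natCast ht, Real.sqrt_eq_rpow]
    norm_num
  have hne : ∀ᵐ x : ESp n, x ≠ 0 := by simp [ae_iff]
  filter_upwards [hne] with x hx
  have hr : 0 < ‖x‖ := norm_pos_iff.2 hx
  have key := rpow_mul_norm_sq_le_of_integrableOn hgdiff (by linarith) (by linarith) hu hv' hr
  rw [hW, hD]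
  refine le_of_sq_le_sq ?_ (by positivity)
  calc (‖x‖ ^ ((2*(n:ℝ) - 2 + b)/4) * ‖f x‖) ^ 2
      = ‖x‖ ^ (((n : ℝ) - 1 + ((n : ℝ) - 1 + b)) / 2) * ‖g ‖x‖‖ ^ 2 := by
        rw [mul_pow, ← Real.rpow_mul_natCast hr.le, hfg x]
        congr 2
        push_cast
        ring
    _ ≤ 2 * (√A * √B) := by
        refine key.trans ?_
        gcongr
        exact setIntegral_mono_on hv' hv measurableSet_Ioi hle
    _ = 2 / κ * √(κ * B) * √(κ * A) := by
        rw [Real.sqrt_mul hκ0.le, Real.sqrt_mul hκ0.le,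
          show 2 / κ * (√κ * √B) * (√κ * √A) = 2 / κ * (√κ * √κ) * (√A * √B) by ring,
          Real.mul_self_sqrt hκ0.le, div_mul_cancel₀ _ hκ0.ne']
    _ = (√(2 / κ) * (κ * B) ^ ((1:ℝ)/4) * (κ * A) ^ ((1:ℝ)/4)) ^ 2 := by
        rw [mul_pow, mul_pow, Real.sq_sqrt (by positivity), hquarter _ (by positivity),
          hquarter _ (by positivity)]
end

section
/- Let n ≥ 3, b > 2−n and −b/2 ≤ d ≤ (2−b)/2. Then there exists a constant C > 0, depending only on n, b and d, such that for every f ∈ C_c^∞(ℝⁿ;ℂ) the Hardy–Sobolev inequality holds: (∫_{ℝⁿ} |x|^{−2nd/(n−2+b+2d)} |f(x)|^{2n/(n−2+b+2d)} dx)^{(n−2+b+2d)/n} ≤ C ∫_{ℝⁿ} |x|^b |∇f(x)|² dx. -/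
open MeasureTheory Real Filter

open scoped Topology

section

theorem HasCompactSupport.norm_sq {α β : Type*} [TopologicalSpace α] [NormedAddCommGroup β]
    {f : α → β} (hf : HasCompactSupport f) : HasCompactSupport fun x ↦ ‖f x‖ ^ 2 :=
  hf.comp_left (g := fun y ↦ ‖y‖ ^ 2) (by simp)

variable {E F : Type*} [NormedAddCommGroup E] [InnerProductSpace ℝ E]
  [NormedAddCommGroup F] [InnerProductSpace ℝ F]

theorem contDiff_norm_sq_add_rpow {ε : ℝ} (hε : 0 < ε) (s : ℝ) {n : WithTop ℕ∞} :
    ContDiff ℝ n fun x : E ↦ (‖x‖ ^ 2 + ε) ^ s :=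
  ((contDiff_norm_sq ℝ).add contDiff_const).rpow_const_of_ne fun x ↦ by positivity

theorem hasFDerivAt_norm_sq_add_rpow {ε : ℝ} (hε : 0 < ε) (s : ℝ) (x : E) :
    HasFDerivAt (fun x : E ↦ (‖x‖ ^ 2 + ε) ^ s)
      ((s * (‖x‖ ^ 2 + ε) ^ (s - 1)) • (2 • innerSL ℝ x)) x :=
  (((hasStrictFDerivAt_norm_sq x).hasFDerivAt).add_const ε).rpow_const
    (.inl (by positivity))

theorem norm_fderiv_norm_sq_add_rpow_smul_sq_le {b ε : ℝ} (hε : 0 < ε) {f : E → F} {x : E}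
    (hf : DifferentiableAt ℝ f x) :
    ‖fderiv ℝ (fun x ↦ (‖x‖ ^ 2 + ε) ^ (b / 4) • f x) x‖ ^ 2 ≤
      2 * ((‖x‖ ^ 2 + ε) ^ (b / 2) * ‖fderiv ℝ f x‖ ^ 2) +
        b ^ 2 / 2 * ((‖x‖ ^ 2 + ε) ^ ((b - 2) / 2) * ‖f x‖ ^ 2) := by
  have h := (hasFDerivAt_norm_sq_add_rpow hε (b / 4) x).smul
    hf.hasFDerivAt
  rw [HasFDerivAt.fderiv (f := fun x ↦ (‖x‖ ^ 2 + ε) ^ (b / 4) • f x) h]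
  set w := ‖x‖ ^ 2 + ε with hw
  have hw0 : 0 < w := by positivity
  set p := w ^ (b / 4 - 1)
  have hp : 0 < p := rpow_pos_of_pos hw0 _
  have e1 : w ^ (b / 4) = p * w := by
    rw [← rpow_add_one hw0.ne']; ring_nf
  have e2 : w ^ (b / 2) = p ^ 2 * w ^ 2 := by
    rw [← rpow_mul_natCast hw0.le, ← rpow_natCast w, ← rpow_add hw0]
    congr 1; push_cast; ring
  have e3 : w ^ ((b - 2) / 2) = p ^ 2 * w := by
    rw [← rpow_mul_natCast hw0.le, ← rpow_add_one hw0.ne']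
    congr 1; push_cast; ring
  rw [e1, e2, e3]
  have hr : ‖x‖ ^ 2 ≤ w := by linarith
  have hle : ‖(p * w) • fderiv ℝ f x + ((b / 4 * p) • (2 • innerSL ℝ x)).smulRight (f x)‖ ≤
      p * w * ‖fderiv ℝ f x‖ + |b| / 2 * p * ‖x‖ * ‖f x‖ := by
    refine (norm_add_le _ _).trans (add_le_add ?_ ?_)
    · rw [norm_smul, norm_of_nonneg (by positivity)]
    · rw [ContinuousLinearMap.norm_smulRight_apply, norm_smul, two_smul, ← two_smul ℝ, norm_smul,
        innerSL_apply_norm]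
      simp only [norm_mul, norm_div, norm_eq_abs, abs_of_pos hp]
      norm_num
      apply le_of_eq
      ring
  refine (pow_le_pow_left₀ (norm_nonneg _) hle 2).trans ?_
  set A := ‖f x‖
  set B := ‖fderiv ℝ f x‖
  set r := ‖x‖
  calc _ ≤ 2 * (p * w * B) ^ 2 + 2 * (|b| / 2 * p * r * A) ^ 2 := by
        nlinarith [sq_nonneg (p * w * B - |b| / 2 * p * r * A)]
    _ = 2 * (p ^ 2 * w ^ 2 * B ^ 2) + b ^ 2 / 2 * (p ^ 2 * r ^ 2 * A ^ 2) := by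
        rw [← sq_abs b]; ring
    _ ≤ _ := by gcongr

variable [MeasurableSpace E] [BorelSpace E]

theorem integrable_norm_sq_add_rpow_mul {ε : ℝ} (hε : 0 < ε) (s : ℝ) {g : E → ℝ}
    (hg : Continuous g) (hgs : HasCompactSupport g) (μ : Measure E) [μ.IsAddHaarMeasure] :
    Integrable (fun x ↦ (‖x‖ ^ 2 + ε) ^ s * g x) μ :=
  ((contDiff_norm_sq_add_rpow hε s (n := 0)).continuous.mul hg).integrable_of_hasCompactSupport
    hgs.mul_left

variable [FiniteDimensional ℝ E]

theorem integral_fderiv_apply_self (μ : Measure E) [μ.IsAddHaarMeasure] {g : E → ℝ}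
    (hg : ContDiff ℝ 1 g) (hgs : HasCompactSupport g) :
    ∫ x, fderiv ℝ g x x ∂μ = -(Module.finrank ℝ E * ∫ x, g x ∂μ) := by
  set v := stdOrthonormalBasis ℝ E
  have hg' : Continuous (fderiv ℝ g) := hg.continuous_fderiv one_ne_zero
  have hgs' : HasCompactSupport (fderiv ℝ g) := hgs.fderiv ℝ
  have hint : ∀ i, Integrable (fun x ↦ inner ℝ (v i) x * fderiv ℝ g x (v i)) μ := fun i ↦ by
    refine Continuous.integrable_of_hasCompactSupport (by fun_prop) ?_
    exact (hgs'.comp_left (g := fun L : E →L[ℝ] ℝ ↦ L (v i)) rfl).mul_left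
  have hparts : ∀ i, ∫ x, inner ℝ (v i) x * fderiv ℝ g x (v i) ∂μ = -∫ x, g x ∂μ := fun i ↦ by
    have hd : ∀ x, fderiv ℝ (fun y : E ↦ inner ℝ (v i) y) x (v i) = 1 := fun x ↦ by
      have h : HasFDerivAt (fun y : E ↦ inner ℝ (v i) y) (innerSL ℝ (v i)) x :=
        (innerSL ℝ (v i)).hasFDerivAt
      rw [h.fderiv]
      simp
    rw [integral_mul_fderiv_eq_neg_fderiv_mul_of_integrable _ (hint i)]
    · simp [hd]
    · exact Continuous.integrable_of_hasCompactSupport (by fun_prop) hgs.mul_left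
    · exact fun x _ ↦ (innerSL ℝ (v i)).differentiableAt
    · exact fun x _ ↦ hg.differentiable one_ne_zero x
    · simpa [hd] using hg.continuous.integrable_of_hasCompactSupport hgs
  have hsum : ∀ x, fderiv ℝ g x x = ∑ i, inner ℝ (v i) x * fderiv ℝ g x (v i) := fun x ↦ by
    conv_lhs => rw [← v.sum_repr' x, map_sum]
    simp [v.sum_repr' x]
  simp_rw [hsum]
  rw [integral_finsetSum _ fun i _ ↦ hint i]
  simp [hparts]

/-- A regularized weighted Hardy inequality. -/
theorem integral_norm_sq_add_rpow_mul_norm_sq_le (μ : Measure E) [μ.IsAddHaarMeasure]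
    {b c ε : ℝ} (hε : 0 < ε) (hc : 0 < c) (hc₁ : c ≤ Module.finrank ℝ E)
    (hc₂ : c ≤ Module.finrank ℝ E + b - 2) {f : E → F} (hf : ContDiff ℝ 1 f)
    (hfs : HasCompactSupport f) :
    ∫ x, (‖x‖ ^ 2 + ε) ^ ((b - 2) / 2) * ‖f x‖ ^ 2 ∂μ ≤
      4 / c ^ 2 * ∫ x, (‖x‖ ^ 2 + ε) ^ (b / 2) * ‖fderiv ℝ f x‖ ^ 2 ∂μ := by
  set N : ℝ := (Module.finrank ℝ E : ℝ)
  set g : E → ℝ := fun x ↦ (‖x‖ ^ 2 + ε) ^ ((b - 2) / 2) * ‖f x‖ ^ 2 with hg_def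
  have hfs2 : HasCompactSupport fun x ↦ ‖f x‖ ^ 2 := hfs.norm_sq
  have hfs3 : HasCompactSupport fun x ↦ ‖fderiv ℝ f x‖ ^ 2 := (hfs.fderiv ℝ).norm_sq
  have hg : ContDiff ℝ 1 g := (contDiff_norm_sq_add_rpow hε _).mul (hf.norm_sq ℝ)
  have hgs : HasCompactSupport g := hfs2.mul_left
  have hcf' : Continuous (fderiv ℝ f) := hf.continuous_fderiv one_ne_zero
  have hig : Integrable g μ := hg.continuous.integrable_of_hasCompactSupport hgs
  have hih : Integrable (fun x ↦ (‖x‖ ^ 2 + ε) ^ (b / 2) * ‖fderiv ℝ f x‖ ^ 2) μ :=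
    integrable_norm_sq_add_rpow_mul hε _ (by fun_prop) hfs3 μ
  have hig' : Integrable (fun x ↦ fderiv ℝ g x x) μ := by
    refine Continuous.integrable_of_hasCompactSupport
      ((hg.continuous_fderiv one_ne_zero).clm_apply continuous_id) ?_
    refine (hgs.fderiv ℝ).mono' fun x hx ↦ subset_closure ?_
    contrapose! hx
    simp_all
  have key : ∀ x, -fderiv ℝ g x x ≤
      (N - c / 2) * g x + 2 / c * ((‖x‖ ^ 2 + ε) ^ (b / 2) * ‖fderiv ℝ f x‖ ^ 2) := fun x ↦ by
    set w := ‖x‖ ^ 2 + ε with hw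
    have hw0 : 0 < w := by positivity
    have hd : fderiv ℝ g x x =
        (b - 2) * w ^ ((b - 2) / 2 - 1) * ‖x‖ ^ 2 * ‖f x‖ ^ 2 +
          2 * w ^ ((b - 2) / 2) * inner ℝ (f x) (fderiv ℝ f x x) := by
      have h := (hasFDerivAt_norm_sq_add_rpow hε ((b - 2) / 2) x).mul
        ((hf.differentiable one_ne_zero x).hasFDerivAt.norm_sq)
      rw [HasFDerivAt.fderiv (f := g) h]
      simp [← hw]
      ring
    set p := w ^ ((b - 2) / 2 - 1)
    have hp : 0 < p := rpow_pos_of_pos hw0 _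
    have e1 : w ^ ((b - 2) / 2) = p * w := by
      rw [← rpow_add_one hw0.ne']; ring_nf
    have e2 : w ^ (b / 2) = p * w ^ 2 := by
      rw [← rpow_natCast, ← rpow_add hw0]; congr 1; push_cast; ring
    have hin : -inner ℝ (f x) (fderiv ℝ f x x) ≤ ‖f x‖ * (‖fderiv ℝ f x‖ * ‖x‖) :=
      (neg_le_abs _).trans <| (abs_real_inner_le_norm _ _).trans <| by
        gcongr; exact (fderiv ℝ f x).le_opNorm x
    simp only [hg_def, ← hw]
    rw [hd, e1, e2]
    set A := ‖f x‖
    set B := ‖fderiv ℝ f x‖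
    set r := ‖x‖
    have hr : r ^ 2 ≤ w := by linarith
    have h1 : 2 * (A * (B * r)) ≤ c / 2 * A ^ 2 + 2 / c * (w * B ^ 2) := by
      have : 2 * (A * (B * r)) ≤ c / 2 * A ^ 2 + 2 / c * (r ^ 2 * B ^ 2) := by
        have : c / 2 * A ^ 2 + 2 / c * (r ^ 2 * B ^ 2) - 2 * (A * (B * r))
          = 1 / (2 * c) * (c * A - 2 * (B * r)) ^ 2 := by field_simp; ring
        have : 0 ≤ 1 / (2 * c) * (c * A - 2 * (B * r)) ^ 2 := by positivity
        linarith
      refine this.trans ?_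
      gcongr
    have h2 : -((b - 2) * r ^ 2) ≤ (N - c) * w := by
      rcases le_total b 2 with hb | hb
      · nlinarith
      · nlinarith [sq_nonneg r]
    calc _ = p * (-((b - 2) * r ^ 2) * A ^ 2 + w * (2 * -inner ℝ (f x) (fderiv ℝ f x x))) := by ring
      _ ≤ p * ((N - c) * w * A ^ 2 + w * (c / 2 * A ^ 2 + 2 / c * (w * B ^ 2))) := by
        gcongr; linarith
      _ = _ := by ring
  have hI := integral_mono (f := fun x ↦ -fderiv ℝ g x x) hig'.neg
    ((hig.const_mul _).add (hih.const_mul _)) key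
  rw [integral_neg, integral_fderiv_apply_self μ hg hgs, neg_neg] at hI
  simp only [Pi.add_apply] at hI
  rw [integral_add (hig.const_mul _) (hih.const_mul _), integral_const_mul, integral_const_mul] at hI
  have : c / 2 * ∫ x, g x ∂μ ≤ 2 / c * ∫ x, (‖x‖ ^ 2 + ε) ^ (b / 2) * ‖fderiv ℝ f x‖ ^ 2 ∂μ := by
    linarith
  calc _ = 2 / c * (c / 2 * ∫ x, g x ∂μ) := by field_simp
    _ ≤ 2 / c * (2 / c * ∫ x, (‖x‖ ^ 2 + ε) ^ (b / 2) * ‖fderiv ℝ f x‖ ^ 2 ∂μ) := by gcongr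
    _ = _ := by ring

theorem integral_norm_rpow_le_integral_norm_fderiv_sq (μ : Measure E) [μ.IsAddHaarMeasure]
    (hE : 2 < Module.finrank ℝ E) :
    ∃ K : ℝ, 0 ≤ K ∧ ∀ u : E → F, ContDiff ℝ 1 u → HasCompactSupport u →
      (∫ x, ‖u x‖ ^ (2 * Module.finrank ℝ E / (Module.finrank ℝ E - 2) : ℝ) ∂μ) ^
          ((Module.finrank ℝ E - 2) / Module.finrank ℝ E : ℝ) ≤
        K * ∫ x, ‖fderiv ℝ u x‖ ^ 2 ∂μ := by
  set N : ℝ := (Module.finrank ℝ E : ℝ) with hN_def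
  have hN : 2 < N := by rw [hN_def]; exact_mod_cast hE
  have hN' : 0 < N - 2 := by linarith
  have hq0 : 0 ≤ 2 * N / (N - 2) := by positivity
  set q : NNReal := ⟨2 * N / (N - 2), hq0⟩ with hq
  have hqc : (q : ℝ) = 2 * N / (N - 2) := rfl
  have hqpos : 0 < (q : ℝ) := by rw [hqc]; positivity
  set K : ℝ := (eLpNormLESNormFDerivOfEqInnerConst μ 2 :)
  refine ⟨K ^ 2, by positivity, fun u hu hus ↦ ?_⟩
  have hGNS := eLpNorm_le_eLpNorm_fderiv_of_eq_inner μ hu hus (p := 2) (p' := q) (by norm_num)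
    (by omega) (by rw [hqc, ← hN_def]; push_cast; field_simp)
  have hcu' := hu.continuous_fderiv one_ne_zero
  have hmu : MemLp u q μ := hu.continuous.memLp_of_hasCompactSupport hus
  have hmu' : MemLp (fderiv ℝ u) (2 : NNReal) μ :=
    hcu'.memLp_of_hasCompactSupport (hus.fderiv ℝ)
  have hq_ne : (q : ENNReal) ≠ 0 := by
    have : q ≠ 0 := fun h ↦ hqpos.ne' (by rw [h]; rfl)
    exact_mod_cast this
  rw [hmu.eLpNorm_eq_integral_rpow_norm hq_ne (by simp),
    hmu'.eLpNorm_eq_integral_rpow_norm (by simp) (by simp),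
    ← ENNReal.ofReal_coe_nnreal (p := eLpNormLESNormFDerivOfEqInnerConst μ _),
    ← ENNReal.ofReal_mul (by positivity), ENNReal.ofReal_le_ofReal_iff (by positivity)] at hGNS
  simp only [ENNReal.coe_toReal, NNReal.coe_ofNat, rpow_ofNat] at hGNS
  rw [hqc] at hGNS
  have hI : 0 ≤ ∫ x, ‖u x‖ ^ (2 * N / (N - 2)) ∂μ := integral_nonneg fun x ↦ by positivity
  have hJ : 0 ≤ ∫ x, ‖fderiv ℝ u x‖ ^ 2 ∂μ := integral_nonneg fun x ↦ by positivity
  have h := pow_le_pow_left₀ (by positivity) hGNS 2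
  rw [mul_pow, ← rpow_mul_natCast hI, ← rpow_mul_natCast hJ] at h
  have he : (2 * N / (N - 2))⁻¹ * (2 : ℕ) = (N - 2) / N := by push_cast; field_simp
  have he' : (2⁻¹ : ℝ) * (2 : ℕ) = 1 := by norm_num
  rwa [he, he', rpow_one] at h

/-- A regularized weighted Sobolev inequality. -/
theorem integral_norm_sq_add_rpow_mul_norm_rpow_le (μ : Measure E) [μ.IsAddHaarMeasure]
    (hE : 2 < Module.finrank ℝ E) {b : ℝ} (hb : 2 - (Module.finrank ℝ E : ℝ) < b) :
    ∃ K : ℝ, 0 ≤ K ∧ ∀ ε : ℝ, 0 < ε → ∀ f : E → F, ContDiff ℝ 1 f → HasCompactSupport f →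
      (∫ x, ((‖x‖ ^ 2 + ε) ^ (b / 4) * ‖f x‖) ^
          (2 * Module.finrank ℝ E / (Module.finrank ℝ E - 2) : ℝ) ∂μ) ^
          ((Module.finrank ℝ E - 2) / Module.finrank ℝ E : ℝ) ≤
        K * ∫ x, (‖x‖ ^ 2 + ε) ^ (b / 2) * ‖fderiv ℝ f x‖ ^ 2 ∂μ := by
  obtain ⟨K, hK, hS⟩ := integral_norm_rpow_le_integral_norm_fderiv_sq (F := F) μ hE
  set N : ℝ := (Module.finrank ℝ E : ℝ) with hN_def
  have hN : 2 < N := by rw [hN_def]; exact_mod_cast hE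
  set c : ℝ := min N (N + b - 2)
  have hc : 0 < c := lt_min (by linarith) (by linarith)
  refine ⟨K * (2 + b ^ 2 / 2 * (4 / c ^ 2)), by positivity, fun ε hε f hf hfs ↦ ?_⟩
  have hfs2 : HasCompactSupport fun x ↦ ‖f x‖ ^ 2 := hfs.norm_sq
  have hfs3 : HasCompactSupport fun x ↦ ‖fderiv ℝ f x‖ ^ 2 := (hfs.fderiv ℝ).norm_sq
  have hcf' : Continuous (fderiv ℝ f) := hf.continuous_fderiv one_ne_zero
  have hcf : Continuous f := hf.continuous
  set u : E → F := fun x ↦ (‖x‖ ^ 2 + ε) ^ (b / 4) • f x with hu_def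
  have hu : ContDiff ℝ 1 u := (contDiff_norm_sq_add_rpow hε _).smul hf
  have hus : HasCompactSupport u := hfs.smul_left
  have hih : Integrable (fun x ↦ (‖x‖ ^ 2 + ε) ^ (b / 2) * ‖fderiv ℝ f x‖ ^ 2) μ :=
    integrable_norm_sq_add_rpow_mul hε _ (by fun_prop) hfs3 μ
  have hig : Integrable (fun x ↦ (‖x‖ ^ 2 + ε) ^ ((b - 2) / 2) * ‖f x‖ ^ 2) μ :=
    integrable_norm_sq_add_rpow_mul hε _ (by fun_prop) hfs2 μ
  have hiu : Integrable (fun x ↦ ‖fderiv ℝ u x‖ ^ 2) μ :=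
    ((hu.continuous_fderiv one_ne_zero).norm.pow 2).integrable_of_hasCompactSupport
      (hus.fderiv ℝ).norm_sq
  have key : ∀ x, ‖fderiv ℝ u x‖ ^ 2 ≤ 2 * ((‖x‖ ^ 2 + ε) ^ (b / 2) * ‖fderiv ℝ f x‖ ^ 2) +
      b ^ 2 / 2 * ((‖x‖ ^ 2 + ε) ^ ((b - 2) / 2) * ‖f x‖ ^ 2) := fun x ↦
    norm_fderiv_norm_sq_add_rpow_smul_sq_le hε (hf.differentiable one_ne_zero x)
  have hI := integral_mono hiu ((hih.const_mul 2).add (hig.const_mul (b ^ 2 / 2))) key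
  simp only [Pi.add_apply] at hI
  rw [integral_add (hih.const_mul _) (hig.const_mul _), integral_const_mul,
    integral_const_mul] at hI
  have hH := integral_norm_sq_add_rpow_mul_norm_sq_le μ hε hc (min_le_left _ _) (min_le_right _ _)
    hf hfs
  have hSu := hS u hu hus
  have hnu : ∀ x, ‖u x‖ = (‖x‖ ^ 2 + ε) ^ (b / 4) * ‖f x‖ := fun x ↦ by
    rw [hu_def, norm_smul, norm_of_nonneg (by positivity)]
  simp_rw [hnu] at hSu
  refine hSu.trans ?_
  rw [mul_assoc]
  gcongr
  refine hI.trans ?_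
  rw [add_mul, mul_assoc]
  gcongr

theorem integral_rpow_mul_rpow_le {α : Type*} [MeasurableSpace α] {μ : Measure α} {g h : α → ℝ}
    (hg : Integrable g μ) (hh : Integrable h μ) (hg0 : ∀ x, 0 ≤ g x) (hh0 : ∀ x, 0 ≤ h x)
    {s t : ℝ} (hs : 0 ≤ s) (ht : 0 ≤ t) (hst : s + t = 1) :
    ∫ x, g x ^ s * h x ^ t ∂μ ≤ (∫ x, g x ∂μ) ^ s * (∫ x, h x ∂μ) ^ t := by
  have hG : 0 ≤ ∫ x, g x ∂μ := integral_nonneg hg0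
  have hH : 0 ≤ ∫ x, h x ∂μ := integral_nonneg hh0
  have key := ENNReal.lintegral_mul_norm_pow_le (μ := μ) hg.aemeasurable.ennreal_ofReal
    hh.aemeasurable.ennreal_ofReal hs ht hst
  rw [← ofReal_integral_eq_lintegral_ofReal hg (.of_forall hg0),
    ← ofReal_integral_eq_lintegral_ofReal hh (.of_forall hh0), ENNReal.ofReal_rpow_of_nonneg hG hs,
    ENNReal.ofReal_rpow_of_nonneg hH ht, ← ENNReal.ofReal_mul (by positivity)] at key
  rw [integral_eq_lintegral_of_nonneg_ae
    (.of_forall fun x ↦ mul_nonneg (rpow_nonneg (hg0 x) _) (rpow_nonneg (hh0 x) _))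
    ((hg.aemeasurable.pow_const _).mul (hh.aemeasurable.pow_const _)).aestronglyMeasurable]
  refine ENNReal.toReal_le_of_le_ofReal (by positivity) (le_trans (le_of_eq ?_) key)
  refine lintegral_congr fun x ↦ ?_
  rw [ENNReal.ofReal_mul (rpow_nonneg (hg0 x) _), ENNReal.ofReal_rpow_of_nonneg (hg0 x) hs,
    ENNReal.ofReal_rpow_of_nonneg (hh0 x) ht]

/-- A regularized weighted Hardy–Sobolev inequality. -/
theorem integral_norm_sq_add_rpow_mul_norm_rpow_le_of_mem_Icc (μ : Measure E) [μ.IsAddHaarMeasure]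
    (hE : 2 < Module.finrank ℝ E) {b θ : ℝ} (hb : 2 - (Module.finrank ℝ E : ℝ) < b)
    (hθ₀ : 0 ≤ θ) (hθ₁ : θ ≤ 1) :
    ∃ K : ℝ, 0 < K ∧ ∀ ε : ℝ, 0 < ε → ∀ f : E → F, ContDiff ℝ 1 f → HasCompactSupport f →
      (∫ x, (‖x‖ ^ 2 + ε) ^
            (Module.finrank ℝ E * (b / 2 - 1 + θ) / (Module.finrank ℝ E - 2 * θ) : ℝ) *
          ‖f x‖ ^ (2 * Module.finrank ℝ E / (Module.finrank ℝ E - 2 * θ) : ℝ) ∂μ) ^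
          ((Module.finrank ℝ E - 2 * θ) / Module.finrank ℝ E : ℝ) ≤
        K * ∫ x, (‖x‖ ^ 2 + ε) ^ (b / 2) * ‖fderiv ℝ f x‖ ^ 2 ∂μ := by
  obtain ⟨K, hK, hS⟩ := integral_norm_sq_add_rpow_mul_norm_rpow_le (F := F) μ hE hb
  set N : ℝ := (Module.finrank ℝ E : ℝ) with hN_def
  have hN : 2 < N := by rw [hN_def]; exact_mod_cast hE
  have hN2 : 0 < N - 2 := by linarith
  have hγ : 0 < N - 2 * θ := by linarith
  have hγ' : N - θ * 2 ≠ 0 := by linarith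
  have hN0 : 0 < N := by linarith
  set c : ℝ := min N (N + b - 2)
  have hc : 0 < c := lt_min hN0 (by linarith)
  refine ⟨4 / c ^ 2 + K, by positivity, fun ε hε f hf hfs ↦ ?_⟩
  have hfs2 : HasCompactSupport fun x ↦ ‖f x‖ ^ 2 := hfs.norm_sq
  have hcf : Continuous f := hf.continuous
  have hH := integral_norm_sq_add_rpow_mul_norm_sq_le μ hε hc (min_le_left _ _) (min_le_right _ _)
    hf hfs
  have hSf := hS ε hε f hf hfs
  have hq : 0 < 2 * N / (N - 2) := by positivity
  have hig : Integrable (fun x ↦ (‖x‖ ^ 2 + ε) ^ ((b - 2) / 2) * ‖f x‖ ^ 2) μ :=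
    integrable_norm_sq_add_rpow_mul hε _ (by fun_prop) hfs2 μ
  have hih : Integrable (fun x ↦ ((‖x‖ ^ 2 + ε) ^ (b / 4) * ‖f x‖) ^ (2 * N / (N - 2))) μ := by
    refine Continuous.integrable_of_hasCompactSupport
      (((contDiff_norm_sq_add_rpow hε (b / 4) (n := 0)).continuous.mul hcf.norm).rpow_const
        fun x ↦ .inr hq.le) ?_
    exact (hfs.norm.mul_left).comp_left (g := fun y : ℝ ↦ y ^ (2 * N / (N - 2))) (zero_rpow hq.ne')
  set G := ∫ x, (‖x‖ ^ 2 + ε) ^ (b / 2) * ‖fderiv ℝ f x‖ ^ 2 ∂μ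
  have hG : 0 ≤ G := integral_nonneg fun x ↦ by positivity
  set H := ∫ x, (‖x‖ ^ 2 + ε) ^ ((b - 2) / 2) * ‖f x‖ ^ 2 ∂μ
  have hH0 : 0 ≤ H := integral_nonneg fun x ↦ by positivity
  set S := ∫ x, ((‖x‖ ^ 2 + ε) ^ (b / 4) * ‖f x‖) ^ (2 * N / (N - 2)) ∂μ
  have hS0 : 0 ≤ S := integral_nonneg fun x ↦ by positivity
  have hθ : 0 ≤ 1 - θ := by linarith
  have hle := integral_rpow_mul_rpow_le hig hih (fun x ↦ by positivity) (fun x ↦ by positivity)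
    (s := N * (1 - θ) / (N - 2 * θ)) (t := θ * (N - 2) / (N - 2 * θ)) (by positivity)
    (by positivity) (by field_simp; ring)
  have hcongr : ∀ x, ((‖x‖ ^ 2 + ε) ^ ((b - 2) / 2) * ‖f x‖ ^ 2) ^ (N * (1 - θ) / (N - 2 * θ)) *
        (((‖x‖ ^ 2 + ε) ^ (b / 4) * ‖f x‖) ^ (2 * N / (N - 2))) ^ (θ * (N - 2) / (N - 2 * θ)) =
      (‖x‖ ^ 2 + ε) ^ (N * (b / 2 - 1 + θ) / (N - 2 * θ)) * ‖f x‖ ^ (2 * N / (N - 2 * θ)) :=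
    fun x ↦ by
      have hw0 : 0 < ‖x‖ ^ 2 + ε := by positivity
      rw [← rpow_natCast ‖f x‖, ← rpow_mul (by positivity), mul_rpow (by positivity) (by positivity),
        mul_rpow (by positivity) (by positivity), ← rpow_mul hw0.le, ← rpow_mul hw0.le,
        ← rpow_mul (norm_nonneg _), mul_mul_mul_comm, ← rpow_add hw0,
        ← rpow_add_of_nonneg (norm_nonneg _) (by positivity) (by positivity)]
      congr 2
      · field_simp; ring
      · push_cast; field_simp; ring
  simp_rw [hcongr] at hle
  have hH' : H ≤ (4 / c ^ 2 + K) * G := hH.trans (by gcongr; linarith)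
  have hS' : S ^ ((N - 2) / N) ≤ (4 / c ^ 2 + K) * G :=
    hSf.trans (by gcongr; exact le_add_of_nonneg_left (by positivity))
  calc _ ≤ (H ^ (N * (1 - θ) / (N - 2 * θ)) * S ^ (θ * (N - 2) / (N - 2 * θ))) ^
          ((N - 2 * θ) / N) :=
        rpow_le_rpow (integral_nonneg fun x ↦ by positivity) hle (by positivity)
    _ = H ^ (1 - θ) * (S ^ ((N - 2) / N)) ^ θ := by
        rw [mul_rpow (by positivity) (by positivity), ← rpow_mul hH0, ← rpow_mul hS0,
          ← rpow_mul hS0]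
        congr 2 <;> field_simp
    _ ≤ ((4 / c ^ 2 + K) * G) ^ (1 - θ) * ((4 / c ^ 2 + K) * G) ^ θ := by gcongr
    _ = _ := by rw [← rpow_add' (by positivity) (by simp)]; simp

theorem integrable_norm_rpow_mul {s : ℝ} (hE : 1 ≤ Module.finrank ℝ E)
    (hs : -(Module.finrank ℝ E : ℝ) < s) {g : E → ℝ} (hg : Continuous g)
    (hgs : HasCompactSupport g) (μ : Measure E) [μ.IsAddHaarMeasure] :
    Integrable (fun x ↦ ‖x‖ ^ s * g x) μ := by
  have hloc : LocallyIntegrable (fun x : E ↦ ‖x‖ ^ s) μ :=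
    locallyIntegrable_of_norm_le_rpow hE (C := 1) (α := -s) (by linarith)
      (.of_forall fun x ↦ by rw [neg_neg, one_mul, norm_of_nonneg (by positivity)])
      (measurable_norm.pow_const s).aestronglyMeasurable
  simpa [mul_comm] using hloc.integrable_smul_left_of_hasCompactSupport hg hgs

theorem tendsto_integral_norm_sq_add_rpow_mul {s : ℝ} (hE : 1 ≤ Module.finrank ℝ E)
    (hs : -(Module.finrank ℝ E : ℝ) < s) {g : E → ℝ} (hg : Continuous g)
    (hgs : HasCompactSupport g) (μ : Measure E) [μ.IsAddHaarMeasure] :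
    Tendsto (fun ε : ℝ ↦ ∫ x, (‖x‖ ^ 2 + ε) ^ (s / 2) * g x ∂μ) (𝓝[>] 0)
      (𝓝 (∫ x, ‖x‖ ^ s * g x ∂μ)) := by
  have : Nontrivial E := Module.nontrivial_of_finrank_pos (R := ℝ) hE
  have h0 : ∀ᵐ x ∂μ, x ≠ 0 := by simp [ae_iff]
  have hsq : ∀ x : E, (‖x‖ ^ 2) ^ (s / 2) = ‖x‖ ^ s := fun x ↦ by
    rw [← rpow_natCast, ← rpow_mul (norm_nonneg _)]
    congr 1; push_cast; ring
  refine tendsto_integral_filter_of_dominated_convergence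
    (fun x ↦ ‖x‖ ^ s * ‖g x‖ + (‖x‖ ^ 2 + 1) ^ (s / 2) * ‖g x‖) ?_ ?_
    ((integrable_norm_rpow_mul hE hs hg.norm hgs.norm μ).add
      (integrable_norm_sq_add_rpow_mul one_pos _ hg.norm hgs.norm μ)) ?_
  · filter_upwards [self_mem_nhdsWithin] with ε hε
    exact (integrable_norm_sq_add_rpow_mul hε _ hg hgs μ).aestronglyMeasurable
  · filter_upwards [Ioo_mem_nhdsGT one_pos] with ε hε
    filter_upwards [h0] with x hx
    have hx0 : 0 < ‖x‖ := norm_pos_iff.2 hx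
    have hε0 := hε.1
    rw [norm_mul, norm_of_nonneg (by positivity), ← add_mul]
    gcongr
    rcases le_total 0 s with h | h
    · refine le_add_of_nonneg_of_le (by positivity) ?_
      have := hε.2
      gcongr
    · refine le_add_of_le_of_nonneg ?_ (by positivity)
      rw [← hsq]
      exact rpow_le_rpow_of_nonpos (by positivity) (by linarith) (by linarith)
  · filter_upwards [h0] with x hx
    have hx0 : 0 < ‖x‖ := norm_pos_iff.2 hx
    refine Tendsto.mul_const _ (Tendsto.mono_left ?_ nhdsWithin_le_nhds)
    rw [← hsq]
    have : Tendsto (fun ε : ℝ ↦ ‖x‖ ^ 2 + ε) (𝓝 0) (𝓝 (‖x‖ ^ 2)) := by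
      simpa using (tendsto_const_nhds (x := ‖x‖ ^ 2)).add (tendsto_id (α := ℝ) (x := 𝓝 0))
    exact this.rpow_const (.inl (by positivity))

/-- A weighted Hardy–Sobolev inequality on a finite-dimensional inner product space. -/
theorem integral_norm_rpow_mul_norm_rpow_le_of_mem_Icc (μ : Measure E) [μ.IsAddHaarMeasure]
    (hE : 2 < Module.finrank ℝ E) {b θ : ℝ} (hb : 2 - (Module.finrank ℝ E : ℝ) < b)
    (hθ₀ : 0 ≤ θ) (hθ₁ : θ ≤ 1) :
    ∃ K : ℝ, 0 < K ∧ ∀ f : E → F, ContDiff ℝ 1 f → HasCompactSupport f →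
      (∫ x, ‖x‖ ^ (Module.finrank ℝ E * (b - 2 + 2 * θ) / (Module.finrank ℝ E - 2 * θ) : ℝ) *
          ‖f x‖ ^ (2 * Module.finrank ℝ E / (Module.finrank ℝ E - 2 * θ) : ℝ) ∂μ) ^
          ((Module.finrank ℝ E - 2 * θ) / Module.finrank ℝ E : ℝ) ≤
        K * ∫ x, ‖x‖ ^ b * ‖fderiv ℝ f x‖ ^ 2 ∂μ := by
  obtain ⟨K, hK, h⟩ :=
    integral_norm_sq_add_rpow_mul_norm_rpow_le_of_mem_Icc (F := F) μ hE hb hθ₀ hθ₁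
  refine ⟨K, hK, fun f hf hfs ↦ ?_⟩
  have hE1 : 1 ≤ Module.finrank ℝ E := by omega
  set N : ℝ := (Module.finrank ℝ E : ℝ) with hN_def
  have hN : 2 < N := by rw [hN_def]; exact_mod_cast hE
  have hγ : 0 < N - 2 * θ := by linarith
  have hN0 : 0 < N := by linarith
  have hq : 0 < 2 * N / (N - 2 * θ) := by positivity
  have hcf' : Continuous (fderiv ℝ f) := hf.continuous_fderiv one_ne_zero
  have hL := tendsto_integral_norm_sq_add_rpow_mul (s := N * (b - 2 + 2 * θ) / (N - 2 * θ))
    (g := fun x ↦ ‖f x‖ ^ (2 * N / (N - 2 * θ))) hE1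
    (by rw [← hN_def, lt_div_iff₀ hγ]; nlinarith)
    (hf.continuous.norm.rpow_const fun x ↦ .inr hq.le)
    (hfs.norm.comp_left (g := fun y : ℝ ↦ y ^ (2 * N / (N - 2 * θ))) (zero_rpow hq.ne')) μ
  have hR := tendsto_integral_norm_sq_add_rpow_mul (s := b) (g := fun x ↦ ‖fderiv ℝ f x‖ ^ 2) hE1
    (by linarith) (by fun_prop)
    (hfs.fderiv ℝ).norm_sq μ
  refine le_of_tendsto_of_tendsto (hL.rpow_const (.inr (by positivity))) (hR.const_mul K) ?_
  filter_upwards [self_mem_nhdsWithin] with ε hε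
  have he : N * (b - 2 + 2 * θ) / (N - 2 * θ) / 2 = N * (b / 2 - 1 + θ) / (N - 2 * θ) := by ring
  simpa only [he] using h ε hε f hf hfs

end

/-- Hardy–Sobolev inequality. -/
theorem hardy_sobolev
    (n : ℕ) (hn : 3 ≤ n) (b d : ℝ) (hb : 2 - (n:ℝ) < b)
    (hd1 : -b/2 ≤ d) (hd2 : d ≤ (2-b)/2) :
    ∃ C > 0, ∀ f : ESp n → ℂ, ContDiff ℝ (⊤ : ℕ∞) f → HasCompactSupport f →
      (wInt n (-(2*(n:ℝ)*d)/((n:ℝ)-2+b+2*d)) (2*(n:ℝ)/((n:ℝ)-2+b+2*d)) f)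
          ^ (((n:ℝ)-2+b+2*d)/(n:ℝ))
        ≤ C * gradInt n b f := by
  have hE : 2 < Module.finrank ℝ (ESp n) := by rw [finrank_euclideanSpace_fin]; exact hn
  obtain ⟨C, hC, h⟩ := integral_norm_rpow_mul_norm_rpow_le_of_mem_Icc (E := ESp n) (F := ℂ)
    volume hE (b := b) (θ := (2 - b - 2 * d) / 2) (by simpa using hb) (by linarith) (by linarith)
  refine ⟨C, hC, fun f hf hfs ↦ ?_⟩
  have hγ : (n : ℝ) - 2 * ((2 - b - 2 * d) / 2) = n - 2 + b + 2 * d := by ring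
  have ha : (n : ℝ) * (b - 2 + 2 * ((2 - b - 2 * d) / 2)) = -(2 * n * d) := by ring
  have hf1 := h f (hf.of_le (by exact_mod_cast le_top)) hfs
  rw [finrank_euclideanSpace_fin, hγ, ha] at hf1
  exact hf1
end

section
/- Let n ≥ 3, 2−n < b < 2, b−2 < c ≤ min{nb/(n−2), 0}, ω > 0, and p > 0 with 2(2−b) < p_c < (2−b)(p+2) where p_c := np − 2c. Let (α,β) ∈ ℝ² satisfy α > 0, β ≥ 0 and 2α − nβ ≥ 0. Let V : ℝⁿ → ℝ be differentiable with V ≥ 0, x·∇V(x) + (2−b)V(x) ≥ 0 and x·∇V(x) ≤ 0 for all x. Then m^{α,β}_{ω,0} ≤ m^{α,β}_{ω,V}, where m^{α,β}_{ω,V} := inf{S_{ω,V}(ψ) : ψ ∈ W_b^{1,2}, ψ ≠ 0, K^{α,β}_{ω,V}(ψ) = 0} and m^{α,β}_{ω,0} is the corresponding infimum with V replaced by 0. -/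
open MeasureTheory Real Filter

/-- An everywhere differentiable function whose derivative vanishes almost everywhere is
constant. -/
theorem Differentiable.apply_eq_of_ae_fderiv_eq_zero {n : ℕ} {f : ESp n → ℂ}
    (hf : Differentiable ℝ f) (h0 : ∀ᵐ x, fderiv ℝ f x = 0) (x y : ESp n) : f x = f y := by
  have hmeas : Measurable (fderiv ℝ f) := measurable_fderiv ℝ f
  have hshift : ∀ v : ESp n, (fun x => f (x + v)) = f := by
    intro v
    have hprod : ∀ᵐ q : ℝ × ESp n, fderiv ℝ f (q.2 + q.1 • v) = 0 := by
      have hset : MeasurableSet {q : ℝ × ESp n | fderiv ℝ f (q.2 + q.1 • v) = 0} := by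
        have : Measurable fun q : ℝ × ESp n => fderiv ℝ f (q.2 + q.1 • v) :=
          hmeas.comp (by fun_prop : Continuous fun q : ℝ × ESp n => q.2 + q.1 • v).measurable
        exact this (measurableSet_singleton 0)
      rw [Measure.volume_eq_prod, Measure.ae_prod_iff_ae_ae hset]
      refine Eventually.of_forall fun t => ?_
      exact (measurePreserving_add_right volume (t • v)).quasiMeasurePreserving.ae h0
    have hswap : ∀ᵐ x : ESp n, ∀ᵐ t : ℝ, fderiv ℝ f (x + t • v) = 0 := by
      have h1 := (Measure.measurePreserving_swap (μ := (volume : Measure (ESp n)))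
        (ν := (volume : Measure ℝ))).quasiMeasurePreserving.ae hprod
      exact Measure.ae_ae_of_ae_prod h1
    refine Continuous.ae_eq_iff_eq (μ := (volume : Measure (ESp n)))
      (hf.continuous.comp (by fun_prop)) hf.continuous |>.1 ?_
    filter_upwards [hswap] with x hx
    have hd : ∀ t : ℝ, HasDerivAt (fun s : ℝ => f (x + s • v)) (fderiv ℝ f (x + t • v) v) t := by
      intro t
      have h1 : HasDerivAt (fun s : ℝ => x + s • v) v t := by
        simpa using ((hasDerivAt_id t).smul_const v).const_add x
      exact (hf (x + t • v)).hasFDerivAt.comp_hasDerivAt t h1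
    have hz : (fun t : ℝ => fderiv ℝ f (x + t • v) v) =ᵐ[volume] fun _ => 0 := by
      filter_upwards [hx] with t ht
      simp [ht]
    have hint : IntervalIntegrable (fun t : ℝ => fderiv ℝ f (x + t • v) v) volume 0 1 :=
      ((integrable_zero ℝ ℂ volume).congr hz.symm).intervalIntegrable
    have hftc := intervalIntegral.integral_eq_sub_of_hasDerivAt (fun t _ => hd t) hint
    have hzero : ∫ t in (0 : ℝ)..1, fderiv ℝ f (x + t • v) v = 0 := by
      rw [intervalIntegral.integral_congr_ae (hz.mono fun t ht _ => ht)]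
      simp
    rw [hzero] at hftc
    simpa using (sub_eq_zero.1 hftc.symm)
  have := congrFun (hshift (x - y)) y
  simpa using this

theorem gradInt_nonneg (n : ℕ) (b : ℝ) (f : ESp n → ℂ) : 0 ≤ gradInt n b f :=
  integral_nonneg fun _ => by positivity

theorem wInt_nonneg (n : ℕ) (a q : ℝ) (f : ESp n → ℂ) : 0 ≤ wInt n a q f :=
  integral_nonneg fun _ => by positivity

theorem gradInt_pos {n : ℕ} (hn : 3 ≤ n) {b : ℝ} {f : ESp n → ℂ} (hf : memW n b f)
    (hne : f ≠ 0) : 0 < gradInt n b f := by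
  obtain ⟨hd, h2, hg⟩ := hf
  have : Nonempty (Fin n) := ⟨⟨0, by omega⟩⟩
  refine lt_of_le_of_ne (gradInt_nonneg n b f) fun h => hne ?_
  have hz := (integral_eq_zero_iff_of_nonneg (fun x => by positivity) hg).1 h.symm
  have h0 : ∀ᵐ x, fderiv ℝ f x = 0 := by
    filter_upwards [hz, Measure.ae_ne volume (0 : ESp n)] with x hx hx0
    have : 0 < ‖x‖ ^ b := rpow_pos_of_pos (norm_pos_iff.2 hx0) b
    simpa [this.ne'] using hx
  have hc := hd.apply_eq_of_ae_fderiv_eq_zero h0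
  have h2' : Integrable (fun _ : ESp n => ‖f 0‖ ^ (2 : ℝ)) :=
    h2.congr (Eventually.of_forall fun x => by simp only [hc x 0])
  rcases integrable_const_iff.1 h2' with h3 | h3
  · funext x
    rw [hc x 0]
    simpa using h3
  · exact absurd h3.measure_univ_lt_top (by simp)

theorem wInt_pos {n : ℕ} (hn : 3 ≤ n) {a q : ℝ} {f : ESp n → ℂ} (hf : Continuous f)
    (hint : Integrable (fun x : ESp n => ‖x‖ ^ a * ‖f x‖ ^ q)) (hne : f ≠ 0) :
    0 < wInt n a q f := by
  have : Nonempty (Fin n) := ⟨⟨0, by omega⟩⟩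
  refine (integral_pos_iff_support_of_nonneg (fun x => by positivity) hint).2 ?_
  have hopen : IsOpen {x | f x ≠ 0} := isOpen_ne_fun hf continuous_const
  obtain ⟨x₀, hx₀⟩ := Function.ne_iff.1 hne
  have hpos : 0 < volume {x | f x ≠ 0} := hopen.measure_pos volume ⟨x₀, hx₀⟩
  rw [← measure_sdiff_null (measure_singleton (0 : ESp n))] at hpos
  refine hpos.trans_le (measure_mono ?_)
  rintro x ⟨hx, hx0⟩
  have h1 : 0 < ‖x‖ := norm_pos_iff.2 hx0
  have h2 : 0 < ‖f x‖ := norm_pos_iff.2 hx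
  exact (by positivity : 0 < ‖x‖ ^ a * ‖f x‖ ^ q).ne'

theorem fderiv_real_smul {n : ℕ} (t : ℝ) {f : ESp n → ℂ} (hf : Differentiable ℝ f) (x : ESp n) :
    fderiv ℝ (t • f) x = t • fderiv ℝ f x :=
  fderiv_const_smul (hf x) t

theorem gradInt_smul {n : ℕ} {b : ℝ} (t : ℝ) {f : ESp n → ℂ} (hf : Differentiable ℝ f) :
    gradInt n b (t • f) = t ^ 2 * gradInt n b f := by
  unfold gradInt
  rw [← integral_const_mul]
  congr 1 with x
  rw [fderiv_real_smul t hf, norm_smul, mul_pow, Real.norm_eq_abs, sq_abs]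
  ring

theorem norm_smul_rpow {n : ℕ} {t : ℝ} (ht : 0 ≤ t) (q : ℝ) (f : ESp n → ℂ) (x : ESp n) :
    ‖(t • f) x‖ ^ q = t ^ q * ‖f x‖ ^ q := by
  rw [Pi.smul_apply, norm_smul, Real.norm_of_nonneg ht, mul_rpow ht (norm_nonneg _)]

theorem norm_smul_sq {n : ℕ} (t : ℝ) (f : ESp n → ℂ) (x : ESp n) :
    ‖(t • f) x‖ ^ 2 = t ^ 2 * ‖f x‖ ^ 2 := by
  rw [Pi.smul_apply, norm_smul, mul_pow, Real.norm_eq_abs, sq_abs]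

theorem wInt_smul {n : ℕ} {a q t : ℝ} (ht : 0 ≤ t) (f : ESp n → ℂ) :
    wInt n a q (t • f) = t ^ q * wInt n a q f := by
  unfold wInt
  rw [← integral_const_mul]
  congr 1 with x
  rw [norm_smul_rpow ht]
  ring

theorem integral_mul_norm_smul_sq {n : ℕ} (W : ESp n → ℝ) (t : ℝ) (f : ESp n → ℂ) :
    ∫ x, W x * ‖(t • f) x‖ ^ 2 = t ^ 2 * ∫ x, W x * ‖f x‖ ^ 2 := by
  rw [← integral_const_mul]
  congr 1 with x
  rw [norm_smul_sq]
  ring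

theorem Vterm_smul {n : ℕ} (V : ESp n → ℝ) (t : ℝ) (f : ESp n → ℂ) :
    Vterm n V (t • f) = t ^ 2 * Vterm n V f :=
  integral_mul_norm_smul_sq V t f

theorem VdV_smul {n : ℕ} (V : ESp n → ℝ) (t : ℝ) (f : ESp n → ℂ) :
    VdV n V (t • f) = t ^ 2 * VdV n V f :=
  integral_mul_norm_smul_sq (fun x => fderiv ℝ V x x) t f

theorem integrable_mul_norm_smul_sq {n : ℕ} {W : ESp n → ℝ} {f : ESp n → ℂ}
    (h : Integrable fun x => W x * ‖f x‖ ^ 2) (t : ℝ) :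
    Integrable fun x => W x * ‖(t • f) x‖ ^ 2 := by
  refine (h.const_mul (t ^ 2)).congr (Eventually.of_forall fun x => ?_)
  simp only [norm_smul_sq]
  ring

theorem integrable_weight_smul {n : ℕ} {a q t : ℝ} (ht : 0 ≤ t) {f : ESp n → ℂ}
    (h : Integrable fun x : ESp n => ‖x‖ ^ a * ‖f x‖ ^ q) :
    Integrable fun x : ESp n => ‖x‖ ^ a * ‖(t • f) x‖ ^ q := by
  refine (h.const_mul (t ^ q)).congr (Eventually.of_forall fun x => ?_)
  simp only [norm_smul_rpow ht]
  ring

theorem memW_smul {n : ℕ} {b t : ℝ} (ht : 0 ≤ t) {f : ESp n → ℂ} (hf : memW n b f) :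
    memW n b (t • f) := by
  obtain ⟨hd, h2, hg⟩ := hf
  refine ⟨hd.const_smul t, ?_, ?_⟩
  · refine (h2.const_mul (t ^ (2 : ℝ))).congr (Eventually.of_forall fun x => ?_)
    simp only [norm_smul_rpow ht]
  · refine (hg.const_mul (t ^ 2)).congr (Eventually.of_forall fun x => ?_)
    simp only [fderiv_real_smul t hd, norm_smul, mul_pow, Real.norm_eq_abs, sq_abs]
    ring

/-- The part of `Kfun` that is quadratic in the function. -/
noncomputable def Kquad (n : ℕ) (b ω α β : ℝ) (V : ESp n → ℝ) (φ : ESp n → ℂ) : ℝ :=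
  ((2*α + (2-b-(n:ℝ))*β)/2) * gradInt n b φ
  + ((2*α - (n:ℝ)*β)/2) * (Vterm n V φ + ω * wInt n 0 2 φ)
  - (β/2) * VdV n V φ

theorem Kfun_smul {n : ℕ} {b c p ω α β : ℝ} (V : ESp n → ℝ) {t : ℝ} (ht : 0 < t)
    {f : ESp n → ℂ} (hf : Differentiable ℝ f) :
    Kfun n b c p ω α β V (t • f) = t ^ 2 * (Kquad n b ω α β V f
      - t ^ p * (((α*(p+2) - ((n:ℝ)+c)*β)/(p+2)) * wInt n c (p+2) f)) := by
  have h2 : t ^ (2 : ℝ) = t ^ 2 := by norm_cast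
  have hp2 : t ^ (p + 2) = t ^ p * t ^ 2 := by rw [rpow_add ht, h2]
  simp only [Kfun, Kquad, gradInt_smul t hf, Vterm_smul, VdV_smul, wInt_smul ht.le, h2, hp2]
  ring

theorem Kfun_smul_eq_zero {n : ℕ} {b c p ω α β : ℝ} (hp : 0 < p) (V : ESp n → ℝ)
    {f : ESp n → ℂ} (hf : Differentiable ℝ f) (hA : 0 < Kquad n b ω α β V f)
    (hB : 0 < ((α*(p+2) - ((n:ℝ)+c)*β)/(p+2)) * wInt n c (p+2) f) :
    Kfun n b c p ω α β V ((Kquad n b ω α β V f /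
      (((α*(p+2) - ((n:ℝ)+c)*β)/(p+2)) * wInt n c (p+2) f)) ^ p⁻¹ • f) = 0 := by
  rw [Kfun_smul V (by positivity) hf, rpow_inv_rpow (by positivity) hp.ne', div_mul_cancel₀ _ hB.ne']
  simp

theorem measurable_fderiv_apply_self {n : ℕ} (V : ESp n → ℝ) :
    Measurable fun x => fderiv ℝ V x x :=
  (isBoundedBilinearMap_apply (𝕜 := ℝ) (E := ESp n) (F := ℝ)).continuous.measurable.comp
    ((measurable_fderiv ℝ V).prodMk measurable_id)

theorem continuous_norm_rpow_mul {n : ℕ} (a : ℝ) {g : ESp n → ℝ} (hg : Continuous g)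
    (h0 : g =ᶠ[nhds 0] 0) : Continuous fun x : ESp n => ‖x‖ ^ a * g x := by
  refine continuous_iff_continuousAt.2 fun x => ?_
  rcases eq_or_ne x 0 with rfl | hx
  · refine (continuousAt_const (y := (0 : ℝ))).congr ?_
    filter_upwards [h0] with y hy
    simp [hy]
  · exact (continuousAt_id.norm.rpow_const (Or.inl (norm_ne_zero_iff.2 hx))).mul hg.continuousAt

theorem HasCompactSupport.of_apply_eq_zero {X E F : Type*} [TopologicalSpace X] [Zero E] [Zero F]
    {f : X → E} {g : X → F} (hf : HasCompactSupport f) (h : ∀ x, f x = 0 → g x = 0) :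
    HasCompactSupport g :=
  hf.mono fun x hx h0 => hx (h x h0)

theorem exists_bump_away_from_zero {n : ℕ} (hn : 3 ≤ n) :
    ∃ f : ESp n → ℂ, ContDiff ℝ 1 f ∧ HasCompactSupport f ∧ f ≠ 0 ∧ f =ᶠ[nhds 0] 0 := by
  let x₀ : ESp n := EuclideanSpace.single ⟨0, by omega⟩ 2
  let η : ContDiffBump x₀ := ⟨1 / 2, 1, by norm_num, by norm_num⟩
  have hx₀ : ‖x₀‖ = 2 := by simp [x₀]
  refine ⟨fun x => ((η x : ℝ) : ℂ), Complex.ofRealCLM.contDiff.comp η.contDiff,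
    η.hasCompactSupport.comp_left (g := fun r : ℝ => (r : ℂ)) Complex.ofReal_zero, ?_, ?_⟩
  · refine Function.ne_iff.2 ⟨x₀, ?_⟩
    have : η x₀ = 1 := η.one_of_mem_closedBall (Metric.mem_closedBall_self η.rIn_pos.le)
    simp [this]
  · filter_upwards [Metric.ball_mem_nhds (0 : ESp n) one_pos] with x hx
    have hx' : ‖x‖ < 1 := by simpa using hx
    have h1 : η x = 0 := by
      refine η.zero_of_le_dist ?_
      have := norm_sub_norm_le x₀ x
      rw [dist_comm, dist_eq_norm]
      change (1 : ℝ) ≤ _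
      linarith
    simp [h1]

theorem exists_admissible {n : ℕ} (hn : 3 ≤ n) (b c : ℝ) {p : ℝ} (hp : 0 < p) {V : ESp n → ℝ}
    (hVdiff : Differentiable ℝ V)
    (hVI : ∀ x, 0 ≤ fderiv ℝ V x x + (2-b) * V x) (hVIII : ∀ x, fderiv ℝ V x x ≤ 0) :
    ∃ f : ESp n → ℂ, memW n b f ∧ f ≠ 0 ∧
      Integrable (fun x : ESp n => ‖x‖ ^ c * ‖f x‖ ^ (p+2)) ∧
      Integrable (fun x : ESp n => V x * ‖f x‖ ^ 2) ∧
      Integrable (fun x : ESp n => (fderiv ℝ V x x) * ‖f x‖ ^ 2) := by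
  obtain ⟨f, hf, hcs, hne, h0⟩ := exists_bump_away_from_zero hn
  have hfc := hf.continuous
  have hfd := hf.continuous_fderiv one_ne_zero
  have hcs' := hcs.fderiv (𝕜 := ℝ)
  have hd0 : fderiv ℝ f =ᶠ[nhds 0] 0 := by
    have := h0.fderiv (𝕜 := ℝ)
    filter_upwards [this] with x hx
    rw [hx]
    simp
  have hp2 : p + 2 ≠ 0 := by positivity
  have hV : Integrable (fun x : ESp n => V x * ‖f x‖ ^ 2) := by
    refine (hVdiff.continuous.mul (hfc.norm.pow 2)).integrable_of_hasCompactSupport ?_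
    exact hcs.of_apply_eq_zero fun x hx => by simp [hx]
  refine ⟨f, ⟨hf.differentiable one_ne_zero, ?_, ?_⟩, hne, ?_, hV, ?_⟩
  · refine (hfc.norm.rpow_const fun _ => Or.inr (by norm_num)).integrable_of_hasCompactSupport ?_
    exact hcs.of_apply_eq_zero fun x hx => by simp [hx]
  · refine (continuous_norm_rpow_mul b (hfd.norm.pow 2) ?_).integrable_of_hasCompactSupport ?_
    · filter_upwards [hd0] with x hx
      simp [hx]
    · exact hcs'.of_apply_eq_zero fun x hx => by simp [hx]
  · refine (continuous_norm_rpow_mul c (hfc.norm.rpow_const fun _ => Or.inr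
      (by positivity : (0 : ℝ) ≤ p + 2)) ?_).integrable_of_hasCompactSupport ?_
    · filter_upwards [h0] with x hx
      simp [hx, hp2]
    · exact hcs.of_apply_eq_zero fun x hx => by simp [hx, hp2]
  · refine (hV.const_mul (2 - b)).mono' ((measurable_fderiv_apply_self V).mul
      (hfc.norm.pow 2).measurable).aestronglyMeasurable (Eventually.of_forall fun x => ?_)
    rw [norm_mul, Real.norm_of_nonpos (hVIII x), Real.norm_of_nonneg (by positivity), ← mul_assoc]
    exact mul_le_mul_of_nonneg_right (by linarith [hVI x]) (by positivity)

/-- `S - K / (2α + (2 - b - n)β)` in expanded form; the gradient term cancels. -/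
theorem Sfun_eq_of_Kfun_eq_zero {n : ℕ} {b c p ω α β : ℝ} (hp : 0 < p)
    (hG : 0 < 2*α + (2-b-(n:ℝ))*β) {V : ESp n → ℝ} {f : ESp n → ℂ}
    (hK : Kfun n b c p ω α β V f = 0) :
    Sfun n b c p ω V f = (2*α + (2-b-(n:ℝ))*β)⁻¹ *
      (β / 2 * ((2-b) * Vterm n V f + VdV n V f) + β * (2-b) / 2 * ω * wInt n 0 2 f
        + (α * p - c * β - (2-b) * β) / (p+2) * wInt n c (p+2) f) := by
  have hp2 : p + 2 ≠ 0 := by positivity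
  have h : Sfun n b c p ω V f =
      Sfun n b c p ω V f - (2*α + (2-b-(n:ℝ))*β)⁻¹ * Kfun n b c p ω α β V f := by
    rw [hK]; ring
  rw [h]
  unfold Sfun Kfun
  have hG' := hG.ne'
  set g := 2*α + (2-b-(n:ℝ))*β with hg
  field_simp
  rw [hg]
  ring

/-- comparison of minimization levels, `m^{α,β}_{ω,0} ≤ m^{α,β}_{ω,V}`. -/
theorem mval_comparison
    (n : ℕ) (hn : 3 ≤ n) (b c p ω α β : ℝ)
    (hb1 : 2 - (n:ℝ) < b) (hb2 : b < 2)
    (hc1 : b - 2 < c) (hc2 : c ≤ min ((n:ℝ)*b/((n:ℝ)-2)) 0)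
    (hω : 0 < ω) (hp : 0 < p)
    (hpc1 : 2*(2-b) < (n:ℝ)*p - 2*c) (hpc2 : (n:ℝ)*p - 2*c < (2-b)*(p+2))
    (hα : 0 < α) (hβ : 0 ≤ β) (hαβ : 0 ≤ 2*α - (n:ℝ)*β)
    (V : ESp n → ℝ) (hVdiff : Differentiable ℝ V) (hVpos : ∀ x, 0 ≤ V x)
    (hVI : ∀ x, 0 ≤ fderiv ℝ V x x + (2-b) * V x)
    (hVIII : ∀ x, fderiv ℝ V x x ≤ 0) :
    mvalV n b c p ω α β (fun _ => 0) ≤ mvalV n b c p ω α β V := by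
  have hbβ : 0 ≤ (2 - b) * β := mul_nonneg (by linarith) hβ
  have hG : 0 < 2*α + (2-b-(n:ℝ))*β := by
    rcases hβ.eq_or_lt with rfl | h
    · linarith
    · nlinarith [mul_pos (sub_pos.2 hb2) h]
  have hJ : 0 ≤ α * p - c * β - (2-b) * β := by
    nlinarith [mul_nonneg hαβ hp.le, mul_nonneg hβ (sub_pos.2 hpc1).le]
  have hN : 0 < α*(p+2) - ((n:ℝ)+c)*β := by linarith
  have hp2 : 0 < p + 2 := by linarith
  have hV0 : ∀ f, Vterm n (fun _ => 0) f = 0 := fun f => by simp [Vterm]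
  have hVd0 : ∀ f, VdV n (fun _ => 0) f = 0 := fun f => by simp [VdV]
  have hVt : ∀ f, 0 ≤ Vterm n V f := fun f =>
    integral_nonneg fun x => mul_nonneg (hVpos x) (by positivity)
  have hVd : ∀ f, VdV n V f ≤ 0 := fun f =>
    integral_nonpos fun x => mul_nonpos_of_nonpos_of_nonneg (hVIII x) (by positivity)
  have hquad0 : ∀ f, memW n b f → f ≠ 0 → 0 < Kquad n b ω α β (fun _ => 0) f := by
    intro f hf hne
    have h1 := mul_pos (half_pos hG) (gradInt_pos hn hf hne)
    have h2 : 0 ≤ (2*α - (n:ℝ)*β)/2 * (ω * wInt n 0 2 f) :=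
      mul_nonneg (by linarith) (mul_nonneg hω.le (wInt_nonneg n 0 2 f))
    unfold Kquad
    rw [hV0, hVd0]
    linarith
  have hquad_le : ∀ f, Kquad n b ω α β (fun _ => 0) f ≤ Kquad n b ω α β V f := by
    intro f
    have h1 : 0 ≤ (2*α - (n:ℝ)*β)/2 * Vterm n V f := mul_nonneg (by linarith) (hVt f)
    have h2 : β / 2 * VdV n V f ≤ 0 := mul_nonpos_of_nonneg_of_nonpos (by linarith) (hVd f)
    unfold Kquad
    rw [hV0, hVd0]
    linarith
  have hBpos : ∀ f, memW n b f → f ≠ 0 →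
      Integrable (fun x : ESp n => ‖x‖ ^ c * ‖f x‖ ^ (p+2)) →
      0 < ((α*(p+2) - ((n:ℝ)+c)*β)/(p+2)) * wInt n c (p+2) f := fun f hf hne hi =>
    mul_pos (div_pos hN hp2) (wInt_pos hn hf.1.continuous hi hne)
  refine le_csInf ?_ ?_
  · obtain ⟨f, hf, hne, h1, h2, h3⟩ := exists_admissible hn b c hp hVdiff hVI hVIII
    have hA := (hquad0 f hf hne).trans_le (hquad_le f)
    have hB := hBpos f hf hne h1
    have ht := rpow_pos_of_pos (div_pos hA hB) p⁻¹
    exact ⟨_, _, memW_smul ht.le hf, smul_ne_zero ht.ne' hne, integrable_weight_smul ht.le h1,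
      integrable_mul_norm_smul_sq h2 _, integrable_mul_norm_smul_sq h3 _,
      Kfun_smul_eq_zero hp V hf.1 hA hB, rfl⟩
  · rintro s ⟨f, hf, hne, h1, h2, h3, hK, rfl⟩
    have hA := hquad0 f hf hne
    have hB := hBpos f hf hne h1
    have hK0 := Kfun_smul_eq_zero hp (fun _ => 0) hf.1 hA hB
    have hle : Kquad n b ω α β (fun _ => 0) f ≤
        ((α*(p+2) - ((n:ℝ)+c)*β)/(p+2)) * wInt n c (p+2) f :=
      (hquad_le f).trans (sub_nonpos.1 (by unfold Kquad; unfold Kfun at hK; exact hK.le))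
    have ht := rpow_pos_of_pos (div_pos hA hB) p⁻¹
    have ht1 : (Kquad n b ω α β (fun _ => 0) f /
        (((α*(p+2) - ((n:ℝ)+c)*β)/(p+2)) * wInt n c (p+2) f)) ^ p⁻¹ ≤ 1 :=
      rpow_le_one (div_pos hA hB).le ((div_le_one hB).2 hle) (inv_nonneg.2 hp.le)
    set t := (Kquad n b ω α β (fun _ => 0) f /
        (((α*(p+2) - ((n:ℝ)+c)*β)/(p+2)) * wInt n c (p+2) f)) ^ p⁻¹
    have hbdd : BddBelow {s : ℝ | ∃ ψ : ESp n → ℂ, memW n b ψ ∧ ψ ≠ 0 ∧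
        Integrable (fun x : ESp n => ‖x‖ ^ c * ‖ψ x‖ ^ (p+2)) ∧
        Integrable (fun x : ESp n => (fun _ => (0 : ℝ)) x * ‖ψ x‖ ^ 2) ∧
        Integrable (fun x : ESp n => (fderiv ℝ (fun _ => (0 : ℝ)) x x) * ‖ψ x‖ ^ 2) ∧
        Kfun n b c p ω α β (fun _ => 0) ψ = 0 ∧ s = Sfun n b c p ω (fun _ => 0) ψ} := by
      refine ⟨0, ?_⟩
      rintro s ⟨ψ, -, -, -, -, -, hψ, rfl⟩
      rw [Sfun_eq_of_Kfun_eq_zero hp hG hψ, hV0, hVd0]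
      have hM := wInt_nonneg n 0 2 ψ
      have hN' := wInt_nonneg n c (p+2) ψ
      have hb : 0 ≤ 2 - b := by linarith
      rw [mul_zero, add_zero, mul_zero, zero_add]
      positivity
    refine (csInf_le hbdd ⟨t • f, memW_smul ht.le hf, smul_ne_zero ht.ne' hne,
      integrable_weight_smul ht.le h1, by simp, by simp, hK0, rfl⟩).trans ?_
    rw [Sfun_eq_of_Kfun_eq_zero hp hG hK0, Sfun_eq_of_Kfun_eq_zero hp hG hK, hV0, hVd0,
      wInt_smul ht.le, wInt_smul ht.le, mul_zero, add_zero, mul_zero, zero_add]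
    have hpot : 0 ≤ (2-b) * Vterm n V f + VdV n V f := by
      unfold Vterm VdV
      rw [← integral_const_mul, ← integral_add (h2.const_mul _) h3]
      refine integral_nonneg fun x => ?_
      have := mul_nonneg (hVI x) (sq_nonneg ‖f x‖)
      change 0 ≤ (2-b) * (V x * ‖f x‖ ^ 2) + fderiv ℝ V x x * ‖f x‖ ^ 2
      linarith
    have hM := mul_le_of_le_one_left (wInt_nonneg n 0 2 f)
      (rpow_le_one ht.le ht1 (by norm_num : (0 : ℝ) ≤ 2))
    have hN' := mul_le_of_le_one_left (wInt_nonneg n c (p+2) f) (rpow_le_one ht.le ht1 hp2.le)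
    have hb : 0 ≤ β * (2-b) / 2 * ω :=
      mul_nonneg (div_nonneg (mul_nonneg hβ (by linarith)) (by norm_num)) hω.le
    refine mul_le_mul_of_nonneg_left ?_ (inv_nonneg.2 hG.le)
    have h4 := mul_le_mul_of_nonneg_left hM hb
    have h5 := mul_le_mul_of_nonneg_left hN' (div_nonneg hJ hp2.le)
    have h6 : 0 ≤ β / 2 * ((2-b) * Vterm n V f + VdV n V f) := mul_nonneg (by linarith) hpot
    linarith
end

section
/- Let n ≥ 2, b ≥ 2−2n, p > 0 and c ∈ ℝ with 4c < (2n−2+b)p (equivalently, 2p_c > (2−b)p where p_c := np − 2c). Then there exists a constant C > 0, depending only on n, b, c and p, such that for every radially symmetric u ∈ W_b^{1,2} and every R > 0, ∫_{|x|>R} |x|^c |u(x)|^{p+2} dx ≤ C · R^{c − (2n−2+b)p/4} · (∫_{ℝⁿ}|x|^b|∇u|²dx)^{p/4} · (∫_{ℝⁿ}|u|²dx)^{p/4 + 1}. -/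
open MeasureTheory Real Filter

/-- A weighted one-dimensional Strauss inequality on the half-line. -/
lemma rpow_mul_sq_norm_le_integral_weighted {g : ℝ → ℂ} (hg : Differentiable ℝ g) {m : ℕ} {β : ℝ}
    (hβ : 0 ≤ m + β)
    (hint : IntegrableOn (fun s : ℝ => s ^ m * ‖g s‖ ^ 2) (Set.Ioi 0))
    (hint' : IntegrableOn (fun s : ℝ => s ^ m * (s ^ β * (‖g s‖ * ‖deriv g s‖))) (Set.Ioi 0))
    {r : ℝ} (hr : 0 < r) :
    r ^ (m + β) * ‖g r‖ ^ 2 ≤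
      2 * ∫ s in Set.Ioi (0 : ℝ), s ^ m * (s ^ β * (‖g s‖ * ‖deriv g s‖)) := by
  have hsub : Set.Ioi r ⊆ Set.Ioi 0 := Set.Ioi_subset_Ioi hr.le
  have hrσ : 0 < r ^ (m + β) := rpow_pos_of_pos hr _
  have hweight : ∀ s ∈ Set.Ioi r, ‖g s‖ * ‖deriv g s‖ ≤
      (r ^ (m + β))⁻¹ * (s ^ m * (s ^ β * (‖g s‖ * ‖deriv g s‖))) := by
    intro s hs
    have hs : r < s := hs
    have h1 : r ^ (m + β) ≤ s ^ m * s ^ β := by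
      rw [← rpow_natCast, ← rpow_add (hr.trans hs)]
      exact rpow_le_rpow hr.le hs.le hβ
    rw [inv_mul_eq_div, le_div_iff₀ hrσ, ← mul_assoc, mul_comm]
    gcongr
  have hsq_int : IntegrableOn (fun s => ‖g s‖ ^ 2) (Set.Ioi r) := by
    refine ((hint.mono_set hsub).const_mul (r ^ m)⁻¹).mono'
      (hg.continuous.norm.pow 2).aestronglyMeasurable ?_
    filter_upwards [ae_restrict_mem measurableSet_Ioi] with s hs
    have hs : r < s := hs
    have h1 : r ^ m ≤ s ^ m := pow_le_pow_left₀ hr.le hs.le m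
    rw [norm_of_nonneg (by positivity), inv_mul_eq_div, le_div_iff₀ (by positivity), mul_comm]
    gcongr
  have hprod_int : IntegrableOn (fun s => ‖g s‖ * ‖deriv g s‖) (Set.Ioi r) := by
    refine ((hint'.mono_set hsub).const_mul (r ^ (m + β))⁻¹).mono' ?_ ?_
    · exact (hg.continuous.norm.measurable.mul (measurable_deriv g).norm).aestronglyMeasurable
    · filter_upwards [ae_restrict_mem measurableSet_Ioi] with s hs
      rw [norm_of_nonneg (by positivity)]
      exact hweight s hs
  have hderiv : ∀ s, HasDerivAt (fun t => ‖g t‖ ^ 2) (2 * inner ℝ (g s) (deriv g s)) s :=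
    fun s => (hg s).hasDerivAt.norm_sq
  have hderiv_le : ∀ s, ‖(2 * inner ℝ (g s) (deriv g s) : ℝ)‖ ≤ 2 * (‖g s‖ * ‖deriv g s‖) := by
    intro s
    rw [norm_mul, norm_of_nonneg (zero_le_two (α := ℝ))]
    gcongr
    exact norm_inner_le_norm _ _
  have hderiv_int : IntegrableOn (fun s => (2 * inner ℝ (g s) (deriv g s) : ℝ)) (Set.Ioi r) := by
    refine (hprod_int.const_mul 2).mono' ?_ (ae_of_all _ hderiv_le)
    exact ((hg.continuous.measurable.inner (measurable_deriv g)).const_mul 2).aestronglyMeasurable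
  have hlim := tendsto_zero_of_hasDerivAt_of_integrableOn_Ioi (fun s _ => hderiv s)
    hderiv_int hsq_int
  have hftc := integral_Ioi_of_hasDerivAt_of_tendsto' (fun s _ => hderiv s) hderiv_int hlim
  have hbound : ‖g r‖ ^ 2 ≤ ∫ s in Set.Ioi r, 2 * (‖g s‖ * ‖deriv g s‖) := by
    calc ‖g r‖ ^ 2 = ‖∫ s in Set.Ioi r, (2 * inner ℝ (g s) (deriv g s) : ℝ)‖ := by
          rw [hftc, zero_sub, norm_neg, norm_of_nonneg (by positivity)]
      _ ≤ _ := norm_integral_le_of_norm_le (hprod_int.const_mul 2) (ae_of_all _ hderiv_le)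
  have hbound' : ∫ s in Set.Ioi r, ‖g s‖ * ‖deriv g s‖ ≤ (r ^ (m + β))⁻¹ *
      ∫ s in Set.Ioi (0 : ℝ), s ^ m * (s ^ β * (‖g s‖ * ‖deriv g s‖)) := by
    calc ∫ s in Set.Ioi r, ‖g s‖ * ‖deriv g s‖
        ≤ ∫ s in Set.Ioi r, (r ^ (m + β))⁻¹ * (s ^ m * (s ^ β * (‖g s‖ * ‖deriv g s‖))) :=
          setIntegral_mono_on hprod_int ((hint'.mono_set hsub).const_mul _) measurableSet_Ioi
            hweight
      _ = (r ^ (m + β))⁻¹ *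
          ∫ s in Set.Ioi r, s ^ m * (s ^ β * (‖g s‖ * ‖deriv g s‖)) := integral_const_mul _ _
      _ ≤ _ := by
          refine mul_le_mul_of_nonneg_left ?_ (by positivity)
          refine setIntegral_mono_set hint' ?_ hsub.eventuallyLE
          filter_upwards [ae_restrict_mem measurableSet_Ioi] with s hs
          have hs : 0 < s := hs
          positivity
  rw [integral_const_mul] at hbound
  rw [inv_mul_eq_div, le_div_iff₀ hrσ] at hbound'
  nlinarith

/-- The profile of a differentiable radial function along a unit vector is differentiable, and
its derivative is dominated by the full derivative. -/
lemma IsRadial.norm_deriv_profile_le {n : ℕ} {u : ESp n → ℂ} (hu : IsRadial n u)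
    (hd : Differentiable ℝ u) {e : ESp n} (he : ‖e‖ = 1) {x : ESp n} (hx : x ≠ 0) :
    ‖deriv (fun t : ℝ => u (t • e)) ‖x‖‖ ≤ ‖fderiv ℝ u x‖ := by
  set v : ESp n := ‖x‖⁻¹ • x
  have hx' : ‖x‖ ≠ 0 := norm_ne_zero_iff.mpr hx
  have hv : ‖v‖ = 1 := by simp [v, norm_smul, hx']
  have hprofile : (fun t : ℝ => u (t • e)) = fun t => u (t • v) := by
    funext t
    exact hu _ _ (by rw [norm_smul, norm_smul, he, hv])
  have hline : HasDerivAt (fun t : ℝ => t • v) v ‖x‖ := by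
    simpa using (hasDerivAt_id ‖x‖).smul_const v
  have hxv : ‖x‖ • v = x := by simp [v, smul_smul, hx']
  have h := (hd (‖x‖ • v)).hasFDerivAt.comp_hasDerivAt ‖x‖ hline
  rw [hprofile, show deriv (fun t : ℝ => u (t • v)) ‖x‖ = _ from h.deriv, hxv]
  simpa [hv] using (fderiv ℝ u x).le_opNorm v

/-- Strauss' radial lemma with a power weight on the gradient. -/
lemma IsRadial.rpow_mul_sq_norm_le {n : ℕ} (hn : 1 ≤ n) {b : ℝ} (hb : 2 - 2 * (n : ℝ) ≤ b)
    {u : ESp n → ℂ} (hu : IsRadial n u) (hW : memW n b u) {x : ESp n} (hx : x ≠ 0) :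
    ‖x‖ ^ ((2 * (n : ℝ) - 2 + b) / 2) * ‖u x‖ ^ 2 ≤
      2 / (n * volume.real (Metric.ball (0 : ESp n) 1)) *
        (gradInt n b u ^ (1 / 2 : ℝ) * wInt n 0 2 u ^ (1 / 2 : ℝ)) := by
  obtain ⟨hd, hL2, hgrad⟩ := hW
  set ω : ℝ := n * volume.real (Metric.ball (0 : ESp n) 1) with hω
  have hn0 : (0 : ℝ) < n := by exact_mod_cast hn
  have hω_pos : 0 < ω :=
    mul_pos hn0 (ENNReal.toReal_pos (Metric.measure_ball_pos _ _ one_pos).ne'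
      measure_ball_lt_top.ne)
  have hx' : 0 < ‖x‖ := norm_pos_iff.mpr hx
  have : Nontrivial (ESp n) := ⟨⟨x, 0, hx⟩⟩
  obtain ⟨e, he⟩ := exists_norm_eq (ESp n) zero_le_one
  set g : ℝ → ℂ := fun t => u (t • e)
  have hgd : Differentiable ℝ g := hd.comp (differentiable_id.smul_const e)
  have hgu : ∀ y : ESp n, g ‖y‖ = u y := fun y => hu _ _ (by simp [norm_smul, he])
  have hfd_meas : Measurable fun y : ESp n => ‖fderiv ℝ u y‖ := (measurable_fderiv ℝ u).norm
  have hL2' : Integrable (fun y : ESp n => ‖u y‖ ^ 2) := by simpa using hL2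
  have hu_mem : MemLp (fun y : ESp n => ‖u y‖) 2 :=
    (memLp_two_iff_integrable_sq hd.continuous.norm.aestronglyMeasurable).2 hL2'
  have hsq : ∀ y : ESp n, (‖y‖ ^ (b / 2) * ‖fderiv ℝ u y‖) ^ 2 = ‖y‖ ^ b * ‖fderiv ℝ u y‖ ^ 2 := by
    intro y
    rw [mul_pow, ← rpow_mul_natCast (norm_nonneg y)]
    norm_num
  have hgrad_mem : MemLp (fun y : ESp n => ‖y‖ ^ (b / 2) * ‖fderiv ℝ u y‖) 2 := by
    refine (memLp_two_iff_integrable_sq ?_).2 ?_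
    · exact ((measurable_norm.pow_const _).mul hfd_meas).aestronglyMeasurable
    · simpa only [hsq] using hgrad
  have hprod_int : Integrable fun y : ESp n => ‖y‖ ^ (b / 2) * ‖fderiv ℝ u y‖ * ‖u y‖ :=
    hgrad_mem.integrable_mul hu_mem
  have hcs : ∫ y : ESp n, ‖y‖ ^ (b / 2) * ‖fderiv ℝ u y‖ * ‖u y‖ ≤
      gradInt n b u ^ (1 / 2 : ℝ) * wInt n 0 2 u ^ (1 / 2 : ℝ) := by
    have h := integral_mul_le_Lp_mul_Lq_of_nonneg (μ := (volume : Measure (ESp n)))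
      Real.HolderConjugate.two_two
      (f := fun y => ‖y‖ ^ (b / 2) * ‖fderiv ℝ u y‖) (g := fun y => ‖u y‖)
      (ae_of_all _ fun y => by positivity) (ae_of_all _ fun y => by positivity)
      (by simpa using hgrad_mem) (by simpa using hu_mem)
    simpa [gradInt, wInt, hsq] using h
  have hle : ∀ᵐ y : ESp n, ‖y‖ ^ (b / 2) * (‖g ‖y‖‖ * ‖deriv g ‖y‖‖) ≤
      ‖y‖ ^ (b / 2) * ‖fderiv ℝ u y‖ * ‖u y‖ := by
    filter_upwards [Measure.ae_ne volume (0 : ESp n)] with y hy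
    rw [hgu, mul_assoc, mul_comm ‖u y‖]
    gcongr
    exact hu.norm_deriv_profile_le hd he hy
  have hrad_int : Integrable fun y : ESp n => ‖y‖ ^ (b / 2) * (‖g ‖y‖‖ * ‖deriv g ‖y‖‖) := by
    refine hprod_int.mono' ?_ ?_
    · have : Measurable fun t : ℝ => t ^ (b / 2) * (‖g t‖ * ‖deriv g t‖) :=
        (measurable_id.pow_const _).mul
          (hgd.continuous.norm.measurable.mul (measurable_deriv g).norm)
      exact (this.comp measurable_norm).aestronglyMeasurable
    · filter_upwards [hle] with y hy
      rwa [norm_of_nonneg (by positivity)]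
  have hrad_le : ∫ y : ESp n, ‖y‖ ^ (b / 2) * (‖g ‖y‖‖ * ‖deriv g ‖y‖‖) ≤
      gradInt n b u ^ (1 / 2 : ℝ) * wInt n 0 2 u ^ (1 / 2 : ℝ) :=
    (integral_mono_ae hrad_int hprod_int hle).trans hcs
  have hpolar := integral_fun_norm_addHaar (volume : Measure (ESp n))
    fun t : ℝ => t ^ (b / 2) * (‖g t‖ * ‖deriv g t‖)
  have hint := (integrable_fun_norm_addHaar (volume : Measure (ESp n))
    (f := fun t : ℝ => t ^ (b / 2) * (‖g t‖ * ‖deriv g t‖))).1 hrad_int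
  have hint_sq := (integrable_fun_norm_addHaar (volume : Measure (ESp n))
    (f := fun t : ℝ => ‖g t‖ ^ 2)).1 (by simpa only [hgu] using hL2')
  simp only [finrank_euclideanSpace, Fintype.card_fin, smul_eq_mul, nsmul_eq_mul]
    at hpolar hint hint_sq
  have hcast : ((n - 1 : ℕ) : ℝ) + b / 2 = (2 * (n : ℝ) - 2 + b) / 2 := by
    push_cast [hn]
    ring
  have h := rpow_mul_sq_norm_le_integral_weighted hgd (by rw [hcast]; linarith) hint_sq hint hx'
  rw [hcast, hgu] at h
  rw [hpolar, ← mul_assoc, ← hω] at hrad_le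
  refine h.trans ?_
  rw [div_mul_eq_mul_div, le_div_iff₀ hω_pos]
  linarith

/-- exterior-ball estimate for the weighted nonlinear term via Strauss. -/
theorem exterior_nonlinear_estimate
    (n : ℕ) (hn : 2 ≤ n) (b c p : ℝ)
    (hb : 2 - 2*(n:ℝ) ≤ b) (hp : 0 < p)
    (hcp : 4*c < (2*(n:ℝ) - 2 + b)*p) :
    ∃ C > 0, ∀ u : ESp n → ℂ, memW n b u → IsRadial n u →
      ∀ R : ℝ, 0 < R →
        (∫ x in {x : ESp n | R < ‖x‖}, ‖x‖ ^ c * ‖u x‖ ^ (p+2)) ≤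
          C * R ^ (c - (2*(n:ℝ) - 2 + b)*p/4)
            * (gradInt n b u) ^ (p/4) * (wInt n 0 2 u) ^ (p/4 + 1) := by
  set ω : ℝ := n * volume.real (Metric.ball (0 : ESp n) 1) with hω
  have hω_pos : 0 < ω :=
    mul_pos (by positivity) (ENNReal.toReal_pos (Metric.measure_ball_pos _ _ one_pos).ne'
      measure_ball_lt_top.ne)
  refine ⟨(2 / ω) ^ (p / 2), by positivity, fun u hW hu R hR => ?_⟩
  set A := gradInt n b u
  set B := wInt n 0 2 u with hB_def
  have hA : 0 ≤ A := integral_nonneg fun x => by positivity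
  have hB : 0 ≤ B := integral_nonneg fun x => by positivity
  set σ : ℝ := (2 * (n : ℝ) - 2 + b) / 2 with hσ
  have hexp : c - (2 * (n : ℝ) - 2 + b) * p / 4 = c - σ * (p / 2) := by rw [hσ]; ring
  have hexp_nonpos : c - σ * (p / 2) ≤ 0 := by rw [← hexp]; linarith
  rw [hexp]
  set D : ℝ := R ^ (c - σ * (p / 2)) * (2 / ω * (A ^ (1 / 2 : ℝ) * B ^ (1 / 2 : ℝ))) ^ (p / 2)
    with hD_def
  have hD : 0 ≤ D := by positivity
  have hpt : ∀ x : ESp n, R < ‖x‖ → ‖x‖ ^ c * ‖u x‖ ^ (p + 2) ≤ D * ‖u x‖ ^ (2 : ℝ) := by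
    intro x hx
    have hx0 : 0 < ‖x‖ := hR.trans hx
    have hstrauss := hu.rpow_mul_sq_norm_le (by omega) hb hW (norm_pos_iff.mp hx0)
    have hfactor : ‖x‖ ^ c * ‖u x‖ ^ (p + 2) =
        ‖x‖ ^ (c - σ * (p / 2)) * (‖x‖ ^ σ * ‖u x‖ ^ 2) ^ (p / 2) * ‖u x‖ ^ (2 : ℝ) := by
      rw [mul_rpow (by positivity) (by positivity), ← rpow_mul hx0.le, ← mul_assoc,
        ← rpow_add hx0, sub_add_cancel, ← rpow_natCast_mul (norm_nonneg _), mul_assoc,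
        ← rpow_add_of_nonneg (norm_nonneg _) (by positivity) (by positivity)]
      congr 2
      push_cast
      ring
    rw [hfactor]
    refine mul_le_mul_of_nonneg_right ?_ (by positivity)
    refine mul_le_mul (rpow_le_rpow_of_nonpos hR hx.le hexp_nonpos) ?_ (by positivity)
      (by positivity)
    exact rpow_le_rpow (by positivity) hstrauss (by positivity)
  have hmeas : MeasurableSet {x : ESp n | R < ‖x‖} :=
    measurableSet_lt measurable_const measurable_norm
  have hB_eq : B = ∫ x : ESp n, ‖u x‖ ^ (2 : ℝ) := by simp [hB_def, wInt]
  calc ∫ x in {x : ESp n | R < ‖x‖}, ‖x‖ ^ c * ‖u x‖ ^ (p + 2)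
      ≤ ∫ x in {x : ESp n | R < ‖x‖}, D * ‖u x‖ ^ (2 : ℝ) := by
        refine integral_mono_of_nonneg (ae_of_all _ fun x => by positivity)
          (hW.2.1.integrableOn.const_mul D) ?_
        filter_upwards [ae_restrict_mem hmeas] with x hx using hpt x hx
    _ ≤ ∫ x, D * ‖u x‖ ^ (2 : ℝ) :=
        setIntegral_le_integral (hW.2.1.const_mul D) (ae_of_all _ fun x => by positivity)
    _ = D * B := by rw [integral_const_mul, hB_eq]
    _ = (2 / ω) ^ (p / 2) * R ^ (c - σ * (p / 2)) * A ^ (p / 4) * B ^ (p / 4 + 1) := by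
        rw [hD_def, mul_rpow (by positivity) (by positivity),
          mul_rpow (by positivity) (by positivity), ← rpow_mul hA, ← rpow_mul hB,
          rpow_add_of_nonneg hB (by positivity) zero_le_one, rpow_one,
          show 1 / 2 * (p / 2) = p / 4 by ring]
        ring
end
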